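/- Let n ≥ 2, let φ be a rational inner function on the polydisc 𝔻ⁿ, let α ∈ 𝕋, and let μ_α be a Clark measure of φ at α. Suppose there exist j ∈ {1,…,n} and a set V ⊆ 𝕋^{n−1} which is the intersection of 𝕋^{n−1} with the common zero set of a finite family of real polynomials in the real and imaginary parts of the coordinates of ℂ^{n−1}, such that ℋ^{n−2}(V) > 0 and pr_j⁻¹(V) is contained in the closure of φ₁⁻¹(α) := {ζ ∈ 𝕋ⁿ : lim_{ρ→1⁻} φ(ρζ) = α}, where pr_j : 𝕋ⁿ → 𝕋^{n−1} deletes the j-th coordinate. Then H²(μ_α) ≠ L²(μ_α). -/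

import Mathlib

open MeasureTheory Filter Set
open scoped ENNReal

noncomputable section

/-- We endow finite-dimensional complex Euclidean spaces with their Borel σ-algebra. -/
instance {ι : Type*} [Fintype ι] : MeasurableSpace (EuclideanSpace ℂ ι) := borel _
instance {ι : Type*} [Fintype ι] : BorelSpace (EuclideanSpace ℂ ι) := ⟨rfl⟩

/-- Evaluation of a polynomial in the variables `ι` at a point of `ℂ^ι`. -/
def pEval {ι : Type*} (p : MvPolynomial ι ℂ) (z : EuclideanSpace ℂ ι) : ℂ :=
  MvPolynomial.eval (fun i => z i) p

/-- The open unit polydisc `𝔻ⁿ` in `ℂⁿ`. -/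
def polydisc (n : ℕ) : Set (EuclideanSpace ℂ (Fin n)) := {z | ∀ j, ‖z j‖ < 1}

/-- The unit torus `𝕋^ι` in `ℂ^ι`. -/
def torus (ι : Type*) : Set (EuclideanSpace ℂ ι) := {ζ | ∀ j, ‖ζ j‖ = 1}

/-- `φ` has radial limit `α` at `ζ`: `φ(ρζ) → α` as `ρ → 1⁻`. -/
def HasRadialLimit {n : ℕ} (φ : EuclideanSpace ℂ (Fin n) → ℂ)
    (ζ : EuclideanSpace ℂ (Fin n)) (α : ℂ) : Prop :=
  Tendsto (fun ρ : ℝ => φ ((ρ : ℂ) • ζ)) (nhdsWithin 1 (Set.Iio 1)) (nhds α)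

/-- `φ` is the rational inner function `p/q` on the polydisc `𝔻ⁿ`: `p, q` have no common
nonconstant factor, `q` is zero-free on `𝔻ⁿ`, `|φ| < 1` on `𝔻ⁿ`, and for a.e. `ζ ∈ 𝕋ⁿ`
(w.r.t. the Haar measure of `𝕋ⁿ`, i.e. up to an `ℋⁿ`-null set) the radial limit of `φ` at `ζ`
exists and is unimodular. -/
structure IsRationalInner (n : ℕ) (p q : MvPolynomial (Fin n) ℂ)
    (φ : EuclideanSpace ℂ (Fin n) → ℂ) : Prop where
  coprime : ∀ d : MvPolynomial (Fin n) ℂ, d ∣ p → d ∣ q → IsUnit d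
  q_ne_zero : ∀ z ∈ polydisc n, pEval q z ≠ 0
  phi_eq : ∀ z ∈ polydisc n, φ z = pEval p z / pEval q z
  abs_lt_one : ∀ z ∈ polydisc n, ‖φ z‖ < 1
  inner : ∃ E ⊆ torus (Fin n), μH[(n : ℝ)] E = 0 ∧
    ∀ ζ ∈ torus (Fin n) \ E, ∃ β : ℂ, ‖β‖ = 1 ∧ HasRadialLimit φ ζ β

/-- `μ` is a Clark measure of `φ` at `α`: a finite positive Borel measure on `𝕋ⁿ` whose
Poisson–Szegő integral is `(1-|φ|²)/|α-φ|²`. -/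
def IsClarkMeasure (n : ℕ) (φ : EuclideanSpace ℂ (Fin n) → ℂ) (α : ℂ)
    (μ : Measure (EuclideanSpace ℂ (Fin n))) : Prop :=
  IsFiniteMeasure μ ∧ μ (torus (Fin n))ᶜ = 0 ∧
    ∀ z ∈ polydisc n,
      ∫⁻ ζ, ENNReal.ofReal (∏ j, (1 - ‖z j‖ ^ 2) / ‖ζ j - z j‖ ^ 2) ∂μ
        = ENNReal.ofReal ((1 - ‖φ z‖ ^ 2) / ‖α - φ z‖ ^ 2)

/-- The subset of `L²(μ)` consisting of (classes of) holomorphic polynomial functions;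
`H²(μ)` is its closure in `L²(μ)`. -/
def polyLp (n : ℕ) (μ : Measure (EuclideanSpace ℂ (Fin n))) : Set (Lp ℂ 2 μ) :=
  {f | ∃ p : MvPolynomial (Fin n) ℂ, ⇑f =ᵐ[μ] pEval p}

/-- `φ₁⁻¹(α)`: the set of `ζ ∈ 𝕋ⁿ` where the radial limit of `φ` exists and equals `α`. -/
def radialFiber {n : ℕ} (φ : EuclideanSpace ℂ (Fin n) → ℂ) (α : ℂ) :
    Set (EuclideanSpace ℂ (Fin n)) :=
  {ζ | ζ ∈ torus (Fin n) ∧ HasRadialLimit φ ζ α}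

/-- The common zero set in `ℂ^ι` of a finite family of real polynomials in the real and
imaginary parts of the coordinates. -/
def realZeroSet {ι : Type*} (s : Finset (MvPolynomial (ι × Bool) ℝ)) :
    Set (EuclideanSpace ℂ ι) :=
  {w | ∀ P ∈ s, MvPolynomial.eval (fun ib => if ib.2 then (w ib.1).re else (w ib.1).im) P = 0}

/-- The projection `ℂⁿ → ℂ^{n-1}` deleting the `j`-th coordinate. -/
def deleteCoord {n : ℕ} (j : Fin n) (ζ : EuclideanSpace ℂ (Fin n)) :
    EuclideanSpace ℂ {i : Fin n // i ≠ j} :=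
  (WithLp.equiv 2 _).symm fun i => ζ i.1

/-- Gauss's lemma in elimination form: two polynomials over a unique factorization domain without
common nonunit divisor generate an ideal containing a nonzero constant. -/
theorem exists_elimination {R : Type*} [CommRing R] [IsDomain R] [UniqueFactorizationMonoid R]
    {P Q : Polynomial R} (h : ∀ d : Polynomial R, d ∣ P → d ∣ Q → IsUnit d) :
    ∃ (A B : Polynomial R) (d : R), d ≠ 0 ∧ P * A + Q * B = Polynomial.C d := by
  classical
  let _ : NormalizedGCDMonoid R := Classical.choice inferInstance
  let K := FractionRing R
  have hinj : Function.Injective (algebraMap R K) := IsFractionRing.injective R K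
  have hPQ : P ≠ 0 ∨ Q ≠ 0 := by
    by_contra! hc
    exact Polynomial.not_isUnit_X (h Polynomial.X (by simp [hc.1]) (by simp [hc.2]))
  have hdvd : ∀ (g : Polynomial R) (f : Polynomial R), g.IsPrimitive →
      g.map (algebraMap R K) ∣ f.map (algebraMap R K) → g ∣ f := fun g f hg hd =>
    hg.dvd_of_fraction_map_dvd_fraction_map hd
  have hcop : IsCoprime (P.map (algebraMap R K)) (Q.map (algebraMap R K)) := by
    refine isCoprime_of_irreducible_dvd ?_ ?_
    · rintro ⟨h1, h2⟩
      rw [Polynomial.map_eq_zero_iff hinj] at h1 h2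
      exact hPQ.elim (· h1) (· h2)
    · intro g hg hgP hgQ
      obtain ⟨b, hb, hb'⟩ := IsLocalization.integerNormalization_spec (nonZeroDivisors R) g
      set g0 := IsLocalization.integerNormalization (nonZeroDivisors R) g
      have hb0 : algebraMap R K b ≠ 0 := by
        simpa using nonZeroDivisors.ne_zero hb
      have hg0 : g0.map (algebraMap R K) ∣ g := by
        rw [hb', ← algebraMap_smul K b g, Polynomial.smul_eq_C_mul]
        exact (IsUnit.mul_left_dvd (Polynomial.isUnit_C.2 hb0.isUnit)).2 dvd_rfl
      have hpp : g0.primPart.map (algebraMap R K) ∣ g :=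
        (Polynomial.map_dvd _ g0.primPart_dvd).trans hg0
      have hu := h g0.primPart (hdvd _ _ g0.isPrimitive_primPart (hpp.trans hgP))
        (hdvd _ _ g0.isPrimitive_primPart (hpp.trans hgQ))
      apply hg.not_isUnit
      have h0 : g0 ≠ 0 := by
        intro h0
        rw [h0, Polynomial.map_zero, ← algebraMap_smul K b g] at hb'
        exact (smul_ne_zero hb0 hg.ne_zero) hb'.symm
      have h1 : IsUnit (g0.map (algebraMap R K)) := by
        rw [g0.eq_C_content_mul_primPart, Polynomial.map_mul, Polynomial.map_C]
        refine IsUnit.mul (Polynomial.isUnit_C.2 (IsUnit.mk0 _ ?_))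
          (hu.map (Polynomial.mapRingHom (algebraMap R K)))
        simpa [Polynomial.content_eq_zero_iff] using h0
      rw [hb', ← algebraMap_smul K b g, Polynomial.smul_eq_C_mul] at h1
      exact isUnit_of_mul_isUnit_right h1
  by_cases hdeg : P.natDegree ≠ 0 ∨ Q.natDegree ≠ 0
  · obtain ⟨A, B, -, -, hAB⟩ :=
      Polynomial.exists_mul_add_mul_eq_C_resultant P Q le_rfl le_rfl hdeg
    refine ⟨A, B, _, ?_, hAB⟩
    have := Polynomial.resultant_ne_zero _ _ hcop
    rw [Polynomial.natDegree_map_eq_of_injective hinj,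
      Polynomial.natDegree_map_eq_of_injective hinj, Polynomial.resultant_map_map] at this
    exact fun h0 => this (by rw [h0, map_zero])
  · push Not at hdeg
    have hP := Polynomial.eq_C_of_natDegree_eq_zero hdeg.1
    have hQ := Polynomial.eq_C_of_natDegree_eq_zero hdeg.2
    rcases hPQ with h0 | h0
    · refine ⟨1, 0, P.coeff 0, fun h1 => h0 ?_, by simpa using hP⟩
      rw [hP, h1, Polynomial.C_0]
    · refine ⟨0, 1, Q.coeff 0, fun h1 => h0 ?_, by simpa using hQ⟩
      rw [hQ, h1, Polynomial.C_0]

/-- Elimination of the variable `i` from two multivariate polynomials without common factor. -/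
theorem exists_elimination_mvPolynomial {σ : Type*} [DecidableEq σ] [Finite σ]
    {p q : MvPolynomial σ ℂ}
    (h : ∀ d : MvPolynomial σ ℂ, d ∣ p → d ∣ q → IsUnit d) (i : σ) :
    ∃ (a b : MvPolynomial σ ℂ) (d : MvPolynomial {k // k ≠ i} ℂ), d ≠ 0 ∧
      p * a + q * b = MvPolynomial.rename Subtype.val d := by
  let ε : MvPolynomial σ ℂ ≃ₐ[ℂ] Polynomial (MvPolynomial {k // k ≠ i} ℂ) :=
    (MvPolynomial.renameEquiv ℂ (Equiv.optionSubtypeNe i).symm).trans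
      (MvPolynomial.optionEquivLeft ℂ _)
  obtain ⟨A, B, d, hd, hAB⟩ := exists_elimination (P := ε p) (Q := ε q) (by
    intro d h1 h2
    have := h (ε.symm d) (by simpa using map_dvd ε.symm h1) (by simpa using map_dvd ε.symm h2)
    simpa using this.map ε)
  refine ⟨ε.symm A, ε.symm B, d, hd, ?_⟩
  apply ε.injective
  rw [map_add, map_mul, map_mul, AlgEquiv.apply_symm_apply, AlgEquiv.apply_symm_apply, hAB]
  have : (Polynomial.CAlgHom : _ →ₐ[MvPolynomial {k // k ≠ i} ℂ] _).restrictScalars ℂ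
      = ε.toAlgHom.comp (MvPolynomial.rename (Subtype.val : {k // k ≠ i} → σ)) := by
    apply MvPolynomial.algHom_ext
    intro k
    simp [ε, Equiv.optionSubtypeNe_symm_of_ne k.2]
  exact DFunLike.congr_fun this d

/-- The projection `ℂ^ι → ℂ^{ι \ {i}}` deleting the `i`-th coordinate. -/
def dropCoord {ι : Type*} (i : ι) (z : EuclideanSpace ℂ ι) : EuclideanSpace ℂ {k // k ≠ i} :=
  WithLp.toLp 2 fun k => z k.1

@[simp]
theorem dropCoord_apply {ι : Type*} (i : ι) (z : EuclideanSpace ℂ ι) (k : {k // k ≠ i}) :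
    dropCoord i z k = z k.1 := rfl

theorem norm_sub_sq_eq_dropCoord {ι : Type*} [Fintype ι] [DecidableEq ι] (i : ι)
    (x y : EuclideanSpace ℂ ι) :
    ‖x - y‖ ^ 2 = ‖x i - y i‖ ^ 2 + ‖dropCoord i x - dropCoord i y‖ ^ 2 := by
  rw [EuclideanSpace.norm_sq_eq, EuclideanSpace.norm_sq_eq,
    ← Fintype.sum_subtype_add_sum_subtype (fun k => k = i)]
  have : ((default : {k // k = i}) : ι) = i := (default : {k // k = i}).2
  simp [this]

theorem norm_sub_le_dropCoord {ι : Type*} [Fintype ι] [DecidableEq ι] (i : ι)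
    (x y : EuclideanSpace ℂ ι) :
    ‖x - y‖ ≤ ‖x i - y i‖ + ‖dropCoord i x - dropCoord i y‖ := by
  have := norm_sub_sq_eq_dropCoord i x y
  have h1 := norm_nonneg (x i - y i)
  have h2 := norm_nonneg (dropCoord i x - dropCoord i y)
  exact le_of_sq_le_sq (by nlinarith) (by positivity)

theorem exists_hasStrictFDerivAt_pEval {ι : Type*} [Fintype ι] [DecidableEq ι]
    (Q : MvPolynomial ι ℂ) (w : EuclideanSpace ℂ ι) :
    ∃ f' : EuclideanSpace ℂ ι →L[ℂ] ℂ, HasStrictFDerivAt (pEval Q) f' w ∧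
      ∀ i, f' (EuclideanSpace.single i 1) = pEval (MvPolynomial.pderiv i Q) w := by
  induction Q using MvPolynomial.induction_on with
  | C a =>
    refine ⟨0, ?_, fun i => by simp [pEval]⟩
    have : pEval (MvPolynomial.C a : MvPolynomial ι ℂ) = fun _ => a := by
      ext z; simp [pEval]
    rw [this]
    exact hasStrictFDerivAt_const _ _
  | add p q hp hq =>
    obtain ⟨f, hf, hf'⟩ := hp
    obtain ⟨g, hg, hg'⟩ := hq
    refine ⟨f + g, ?_, fun i => by simp [pEval] at *; rw [hf', hg']⟩
    have : pEval (p + q) = fun z => pEval p z + pEval q z := by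
      ext z; simp [pEval]
    rw [this]
    exact hf.add hg
  | mul_X p k hp =>
    obtain ⟨f, hf, hf'⟩ := hp
    refine ⟨pEval p w • EuclideanSpace.proj k + w k • f, ?_, fun i => ?_⟩
    · have : pEval (p * MvPolynomial.X k) = fun z => pEval p z * z k := by
        ext z; simp [pEval]
      rw [this]
      exact hf.mul (EuclideanSpace.proj k : EuclideanSpace ℂ ι →L[ℂ] ℂ).hasStrictFDerivAt
    · simp only [add_apply, smul_apply, hf',
        MvPolynomial.pderiv_mul, MvPolynomial.pderiv_X]
      by_cases h : k = i
      · subst h; simp [pEval]; ring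
      · simp [pEval, h]; ring

theorem continuous_pEval {ι : Type*} [Fintype ι] (Q : MvPolynomial ι ℂ) :
    Continuous (pEval Q) := by
  unfold pEval
  exact (MvPolynomial.continuous_eval Q).comp (by fun_prop)

/-- Near a point of a hypersurface at which `∂ᵢ` of the defining polynomial does not vanish, the
projection of the hypersurface along the `i`-th coordinate is bilipschitz. -/
theorem exists_antilipschitz_dropCoord {ι : Type*} [Fintype ι] [DecidableEq ι]
    (Q : MvPolynomial ι ℂ) (i : ι) {w : EuclideanSpace ℂ ι}
    (hw : pEval (MvPolynomial.pderiv i Q) w ≠ 0) :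
    ∃ u ∈ nhds w, ∃ C : NNReal, ∀ x ∈ u, ∀ y ∈ u, pEval Q x = 0 → pEval Q y = 0 →
      dist x y ≤ C * dist (dropCoord i x) (dropCoord i y) := by
  obtain ⟨f, hf, hf'⟩ := exists_hasStrictFDerivAt_pEval Q w
  set b := ‖pEval (MvPolynomial.pderiv i Q) w‖ with hb
  have hb0 : 0 < b := norm_pos_iff.2 hw
  have hlo := hf.isLittleO.def (show 0 < b / 2 by positivity)
  rw [nhds_prod_eq] at hlo
  obtain ⟨u, hu, hu'⟩ := Filter.eventually_prod_self_iff'.1 hlo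
  refine ⟨u, hu, (2 * ‖f‖₊ / ‖pEval (MvPolynomial.pderiv i Q) w‖₊ + 2), ?_⟩
  intro x hx y hy hQx hQy
  have h1 := hu' x hx y hy
  simp only [hQx, hQy, sub_self, zero_sub, norm_neg] at h1
  set t := ‖x i - y i‖
  set D := ‖dropCoord i x - dropCoord i y‖ with hD
  have h2 := norm_sub_le_dropCoord i x y
  set r : EuclideanSpace ℂ ι := x - y - EuclideanSpace.single i (x i - y i) with hr
  have h3 : ‖r‖ = D := by
    have := norm_sub_sq_eq_dropCoord i r 0
    have e1 : r i = 0 := by simp [hr]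
    have e2 : dropCoord i r - dropCoord i 0 = dropCoord i x - dropCoord i y := by
      ext k
      simp [hr, k.2]
    rw [e2, ← hD, e1] at this
    simp only [PiLp.zero_apply, sub_zero, norm_zero] at this
    nlinarith [norm_nonneg r, norm_nonneg (dropCoord i x - dropCoord i y)]
  have h4 : f (x - y) = (x i - y i) * pEval (MvPolynomial.pderiv i Q) w + f r := by
    rw [← hf' i, ← smul_eq_mul, ← map_smul, ← map_add]
    congr 1
    rw [hr]
    ext k
    by_cases h : k = i <;> simp [h]
  have h5 : t * b ≤ ‖f (x - y)‖ + ‖f‖ * D := by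
    have : (x i - y i) * pEval (MvPolynomial.pderiv i Q) w = f (x - y) - f r := by
      rw [h4]; ring
    rw [← norm_mul, this]
    refine (norm_sub_le _ _).trans ?_
    gcongr
    rw [← h3]
    exact f.le_opNorm r
  have h6 : t * b ≤ (2 * ‖f‖ + b) * D := by nlinarith
  have h7 : t ≤ (2 * ‖f‖ / b + 1) * D := by
    rw [← mul_le_mul_iff_left₀ hb0]
    refine h6.trans_eq ?_
    field_simp
  rw [dist_eq_norm, dist_eq_norm]
  refine h2.trans ?_
  push_cast
  change t + D ≤ (2 * ‖f‖ / b + 2) * D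
  linarith

theorem totalDegree_pderiv_lt {σ : Type*} {Q : MvPolynomial σ ℂ} {i : σ}
    (h : MvPolynomial.pderiv i Q ≠ 0) :
    (MvPolynomial.pderiv i Q).totalDegree < Q.totalDegree := by
  classical
  obtain ⟨m, hm⟩ := MvPolynomial.ne_zero_iff.1 h
  have key : ∀ m ∈ (MvPolynomial.pderiv i Q).support, (m.sum fun _ e => e) < Q.totalDegree := by
    intro m hm
    rw [MvPolynomial.mem_support_iff, MvPolynomial.coeff_pderiv] at hm
    have h1 : m + Finsupp.single i 1 ∈ Q.support :=
      MvPolynomial.mem_support_iff.2 (left_ne_zero_of_mul hm)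
    have h2 := MvPolynomial.le_totalDegree h1
    rw [Finsupp.sum_add_index' (fun _ => rfl) (fun _ _ _ => rfl)] at h2
    simp at h2
    omega
  rw [MvPolynomial.totalDegree, Finset.sup_lt_iff]
  · exact key
  · exact lt_of_le_of_lt (Nat.zero_le _) (key m (MvPolynomial.mem_support_iff.2 hm))

theorem exists_pderiv_ne_zero {σ : Type*} {Q : MvPolynomial σ ℂ} (h : Q.totalDegree ≠ 0) :
    ∃ i, MvPolynomial.pderiv i Q ≠ 0 := by
  classical
  by_contra! h0
  apply h
  rw [MvPolynomial.totalDegree_eq_zero_iff]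
  intro m hm i
  by_contra hi
  have := congrArg (MvPolynomial.coeff (m - Finsupp.single i 1)) (h0 i)
  rw [MvPolynomial.coeff_pderiv, MvPolynomial.coeff_zero, tsub_add_cancel_of_le
    (by simpa [Finsupp.single_le_iff] using Nat.one_le_iff_ne_zero.2 hi)] at this
  rcases mul_eq_zero.1 this with h1 | h1
  · exact MvPolynomial.mem_support_iff.1 hm h1
  · exact Nat.cast_add_one_ne_zero _ h1

theorem hausdorffMeasure_eq_zero_of_image {X Y : Type*} [MetricSpace X] [MetricSpace Y]
    [MeasurableSpace X] [BorelSpace X] [MeasurableSpace Y] [BorelSpace Y] {s : ℝ} (hs : 0 ≤ s)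
    (f : X → Y) {T : Set X} {C : NNReal}
    (hf : ∀ x ∈ T, ∀ y ∈ T, dist x y ≤ C * dist (f x) (f y)) (h0 : μH[s] (f '' T) = 0) :
    μH[s] T = 0 := by
  have ha : AntilipschitzWith C (fun x : T => f x) :=
    AntilipschitzWith.of_le_mul_dist fun x y => hf x x.2 y y.2
  have h1 := ha.le_hausdorffMeasure_image hs univ
  have h2 : (fun x : T => f x) '' univ = f '' T := by
    ext; simp
  rw [h2, h0, mul_zero] at h1
  have h3 := (isometry_subtype_coe (s := T)).hausdorffMeasure_image (d := s) (Or.inl hs) univ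
  rw [image_univ, Subtype.range_coe] at h3
  rw [h3]
  exact le_antisymm h1 zero_le

/-- A set whose coordinate projections are all `μH[s]`-null meets every algebraic hypersurface in a
`μH[s]`-null set. -/
theorem hausdorffMeasure_inter_zeroSet_eq_zero {ι : Type*} [Fintype ι] [DecidableEq ι] {s : ℝ}
    (hs : 0 ≤ s) {Z : Set (EuclideanSpace ℂ ι)} (hZ : ∀ i, μH[s] (dropCoord i '' Z) = 0)
    {Q : MvPolynomial ι ℂ} (hQ : Q ≠ 0) : μH[s] (Z ∩ {z | pEval Q z = 0}) = 0 := by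
  induction hd : Q.totalDegree using Nat.strong_induction_on generalizing Q with
  | _ d ih =>
    by_cases hd0 : Q.totalDegree = 0
    · rw [MvPolynomial.totalDegree_eq_zero_iff_eq_C] at hd0
      have h0 : Q.coeff 0 ≠ 0 := by
        rintro h
        rw [h, map_zero] at hd0
        exact hQ hd0
      have : Z ∩ {z | pEval Q z = 0} = ∅ := by
        ext z
        simp only [mem_inter_iff, mem_ofPred_eq, mem_empty_iff_false, iff_false, not_and]
        intro _
        rw [hd0]
        simpa [pEval] using h0
      rw [this, measure_empty]
    obtain ⟨i, hi⟩ := exists_pderiv_ne_zero hd0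
    have h1 := ih _ (hd ▸ totalDegree_pderiv_lt hi) hi rfl
    have h2 : μH[s] (Z ∩ {z | pEval Q z = 0} ∩ {z | pEval (MvPolynomial.pderiv i Q) z ≠ 0}) =
        0 := by
      refine measure_null_of_locally_null _ fun w hw => ?_
      obtain ⟨u, hu, C, hC⟩ := exists_antilipschitz_dropCoord Q i hw.2
      refine ⟨Z ∩ {z | pEval Q z = 0} ∩ {z | pEval (MvPolynomial.pderiv i Q) z ≠ 0} ∩ u,
        inter_mem self_mem_nhdsWithin (mem_nhdsWithin_of_mem_nhds hu), ?_⟩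
      refine hausdorffMeasure_eq_zero_of_image hs (dropCoord i) (C := C)
        (fun x hx y hy => hC x hx.2 y hy.2 hx.1.1.2 hy.1.1.2) ?_
      exact measure_mono_null (image_mono fun x hx => hx.1.1.1) (hZ i)
    refine measure_mono_null (fun z hz => ?_) (measure_union_null h1 h2)
    by_cases h : pEval (MvPolynomial.pderiv i Q) z = 0
    · exact Or.inl ⟨hz.1, h⟩
    · exact Or.inr ⟨hz, h⟩

theorem hausdorffMeasure_torus_eq_zero {ι : Type*} [Fintype ι] {s : ℝ}
    (hs : (Fintype.card ι : ℝ) < s) : μH[s] (torus ι) = 0 := by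
  let f : (ι → ℝ) → EuclideanSpace ℂ ι := fun θ => WithLp.toLp 2 fun k =>
    Complex.exp ((θ k : ℂ) * Complex.I)
  have hf : ContDiff ℝ 1 f := by
    rw [contDiff_piLp]
    intro i
    refine Complex.contDiff_exp.comp ?_
    refine ContDiff.mul ?_ contDiff_const
    exact Complex.ofRealCLM.contDiff.comp (contDiff_apply ℝ ℝ i)
  have h1 : dimH (torus ι) ≤ Fintype.card ι := by
    refine (dimH_mono ?_).trans (hf.dimH_range_le.trans (by simp))
    intro z hz
    refine ⟨fun k => (z k).arg, ?_⟩
    ext k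
    have := Complex.norm_mul_exp_arg_mul_I (z k)
    rw [hz k] at this
    simpa [f] using this
  have hs0 : 0 ≤ s := (Nat.cast_nonneg _).trans hs.le
  lift s to NNReal using hs0
  refine hausdorffMeasure_of_dimH_lt (h1.trans_lt ?_)
  exact_mod_cast hs

theorem dropCoord_mem_torus {ι : Type*} {i : ι} {z : EuclideanSpace ℂ ι} (hz : z ∈ torus ι) :
    dropCoord i z ∈ torus {k // k ≠ i} := fun k => hz k

theorem hausdorffMeasure_torus_inter_zeroSet_eq_zero {ι : Type*} [Fintype ι] [DecidableEq ι] {s : ℝ}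
    (hs0 : 0 ≤ s) (hs : (Fintype.card ι : ℝ) - 1 < s)
    {Q : MvPolynomial ι ℂ} (hQ : Q ≠ 0) : μH[s] (torus ι ∩ {z | pEval Q z = 0}) = 0 := by
  refine hausdorffMeasure_inter_zeroSet_eq_zero hs0 (fun i => ?_) hQ
  refine measure_mono_null 
    ((image_subset_iff (t := torus {k // k ≠ i})).2 fun z hz => dropCoord_mem_torus hz)
    (hausdorffMeasure_torus_eq_zero ?_)
  have : 1 ≤ Fintype.card ι := Fintype.card_pos_iff.2 ⟨i⟩
  rw [show Fintype.card {k // k ≠ i} = Fintype.card ι - 1 by simp, Nat.cast_sub this]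
  simpa using hs

/-- A subset of the torus on which a nonzero polynomial vanishes, and from which each variable can
be eliminated, has codimension at least two. -/
theorem hausdorffMeasure_eq_zero_of_elimination {ι : Type*} [Fintype ι] [DecidableEq ι] {s : ℝ}
    (hs0 : 0 ≤ s) (hs : (Fintype.card ι : ℝ) - 2 < s) {Z : Set (EuclideanSpace ℂ ι)}
    (hZ : Z ⊆ torus ι) {Q : MvPolynomial ι ℂ} (hQ : Q ≠ 0) (hZQ : ∀ z ∈ Z, pEval Q z = 0)
    (hd : ∀ i, ∃ d : MvPolynomial {k // k ≠ i} ℂ, d ≠ 0 ∧ ∀ z ∈ Z, pEval d (dropCoord i z) = 0) :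
    μH[s] Z = 0 := by
  have : Z = Z ∩ {z | pEval Q z = 0} := (inter_eq_left.2 hZQ).symm
  rw [this]
  refine hausdorffMeasure_inter_zeroSet_eq_zero hs0 (fun i => ?_) hQ
  obtain ⟨d, hd0, hd⟩ := hd i
  refine measure_mono_null ((image_subset_iff (t := torus {k // k ≠ i} ∩ {z | pEval d z = 0})).2
    fun z hz => ⟨dropCoord_mem_torus (hZ hz), hd z hz⟩)
    (hausdorffMeasure_torus_inter_zeroSet_eq_zero hs0 ?_ hd0)
  have : 1 ≤ Fintype.card ι := Fintype.card_pos_iff.2 ⟨i⟩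
  rw [show Fintype.card {k // k ≠ i} = Fintype.card ι - 1 by simp, Nat.cast_sub this]
  push_cast
  linarith

/-- The point of `ℂⁿ` with `j`-th coordinate `a` and remaining coordinates `w`. -/
def insertCoord {n : ℕ} (j : Fin n) (a : ℂ) (w : EuclideanSpace ℂ {i : Fin n // i ≠ j}) :
    EuclideanSpace ℂ (Fin n) :=
  WithLp.toLp 2 fun i => if h : i = j then a else w ⟨i, h⟩

@[simp]
theorem insertCoord_self {n : ℕ} (j : Fin n) (a : ℂ) (w : EuclideanSpace ℂ {i : Fin n // i ≠ j}) :
    insertCoord j a w j = a := by simp [insertCoord]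

@[simp]
theorem insertCoord_coe {n : ℕ} (j : Fin n) (a : ℂ) (w : EuclideanSpace ℂ {i : Fin n // i ≠ j})
    (k : {i : Fin n // i ≠ j}) : insertCoord j a w k = w k := by
  simp [insertCoord, k.2]

@[simp]
theorem deleteCoord_apply {n : ℕ} (j : Fin n) (z : EuclideanSpace ℂ (Fin n))
    (k : {i : Fin n // i ≠ j}) : deleteCoord j z k = z k := rfl

theorem deleteCoord_insertCoord {n : ℕ} (j : Fin n) (a : ℂ)
    (w : EuclideanSpace ℂ {i : Fin n // i ≠ j}) : deleteCoord j (insertCoord j a w) = w := by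
  ext k; simp

theorem insertCoord_deleteCoord {n : ℕ} (j : Fin n) (z : EuclideanSpace ℂ (Fin n)) :
    insertCoord j (z j) (deleteCoord j z) = z := by
  ext k
  by_cases h : k = j
  · subst h; simp
  · exact insertCoord_coe j _ _ ⟨k, h⟩

theorem forall_insertCoord {n : ℕ} {j : Fin n} {a : ℂ} {w : EuclideanSpace ℂ {i : Fin n // i ≠ j}}
    {P : ℂ → Prop} : (∀ i, P (insertCoord j a w i)) ↔ P a ∧ ∀ k, P (w k) := by
  refine ⟨fun h => ⟨by simpa using h j, fun k => by simpa using h k⟩, fun h i => ?_⟩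
  by_cases hi : i = j
  · subst hi; simpa using h.1
  · simpa using (insertCoord_coe j a w ⟨i, hi⟩) ▸ h.2 ⟨i, hi⟩

theorem continuous_insertCoord {n : ℕ} (j : Fin n) (a : ℂ) : Continuous (insertCoord j a) := by
  refine (PiLp.continuous_toLp 2 _).comp (continuous_pi fun i => ?_)
  by_cases h : i = j
  · simpa [h] using continuous_const
  · simp only [h, dite_false]; fun_prop

theorem continuous_deleteCoord {n : ℕ} (j : Fin n) : Continuous (deleteCoord j) :=
  (PiLp.continuous_toLp 2 _).comp (continuous_pi fun i => by fun_prop)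

theorem norm_insertCoord_sub {n : ℕ} (j : Fin n) (a : ℂ)
    (v w : EuclideanSpace ℂ {i : Fin n // i ≠ j}) :
    ‖insertCoord j a v - insertCoord j a w‖ = ‖v - w‖ := by
  have h := norm_sub_sq_eq_dropCoord j (insertCoord j a v) (insertCoord j a w)
  rw [show dropCoord j (insertCoord j a v) = v from deleteCoord_insertCoord j a v,
    show dropCoord j (insertCoord j a w) = w from deleteCoord_insertCoord j a w] at h
  simp only [insertCoord_self, sub_self, norm_zero] at h
  nlinarith [norm_nonneg (insertCoord j a v - insertCoord j a w), norm_nonneg (v - w)]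

theorem exists_polynomial_insertCoord {n : ℕ} (j : Fin n) (a : ℂ) (Q : MvPolynomial (Fin n) ℂ) :
    ∃ Q' : MvPolynomial {i : Fin n // i ≠ j} ℂ, ∀ w, pEval Q' w = pEval Q (insertCoord j a w) := by
  refine ⟨MvPolynomial.aeval (fun k => if h : k = j then MvPolynomial.C a
    else MvPolynomial.X ⟨k, h⟩) Q, fun w => ?_⟩
  unfold pEval
  rw [← MvPolynomial.coe_aeval_eq_eval, ← MvPolynomial.coe_aeval_eq_eval]
  simp only [RingHom.coe_coe]
  rw [← AlgHom.comp_apply, MvPolynomial.comp_aeval]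
  congr 2
  ext k
  by_cases h : k = j
  · subst h; simp
  · rw [dif_neg h]; simpa using (insertCoord_coe j a w ⟨k, h⟩).symm

theorem exists_polynomial_elimination {n : ℕ} (j : Fin n) (a : ℂ) (i : {i : Fin n // i ≠ j})
    (d : MvPolynomial {k : Fin n // k ≠ i} ℂ) :
    ∃ d' : MvPolynomial {k : {i : Fin n // i ≠ j} // k ≠ i} ℂ, ∀ w,
      pEval d' (dropCoord i w) = pEval (MvPolynomial.rename Subtype.val d) (insertCoord j a w) := by
  refine ⟨MvPolynomial.aeval (fun k => if h : k.1 = j then MvPolynomial.C a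
    else MvPolynomial.X ⟨⟨k.1, h⟩, fun h' => k.2 (congrArg Subtype.val h')⟩) d, fun w => ?_⟩
  unfold pEval
  rw [MvPolynomial.eval_rename, ← MvPolynomial.coe_aeval_eq_eval, ← MvPolynomial.coe_aeval_eq_eval]
  simp only [RingHom.coe_coe]
  rw [← AlgHom.comp_apply, MvPolynomial.comp_aeval]
  congr 2
  ext k
  by_cases h : k.1 = j
  · simp [h]
  · rw [dif_neg h]; simpa using (insertCoord_coe j a w ⟨k, h⟩).symm

theorem exists_mem_polydisc_pEval_ne_zero {n : ℕ} {F : MvPolynomial (Fin n) ℂ} (hF : F ≠ 0) :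
    ∃ z ∈ polydisc n, pEval F z ≠ 0 := by
  by_contra! h
  apply hF
  refine MvPolynomial.funext_set (fun _ => Metric.ball (0 : ℂ) 1) (fun _ => ?_) fun x hx => ?_
  · exact infinite_of_mem_nhds (0 : ℂ) (Metric.ball_mem_nhds _ one_pos)
  · simpa [pEval] using h (WithLp.toLp 2 x) fun i => by simpa using hx i trivial

/-- For a suitable `a ∈ 𝔻`, the common zeros of `p` and `q` on `{a} × 𝕋ⁿ⁻¹` form an
`ℋⁿ⁻²`-null set. -/
theorem exists_slice_null {n : ℕ} (hn : 2 ≤ n) {p q : MvPolynomial (Fin n) ℂ}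
    (hpq : ∀ d : MvPolynomial (Fin n) ℂ, d ∣ p → d ∣ q → IsUnit d)
    (hq : ∀ z ∈ polydisc n, pEval q z ≠ 0) (j : Fin n) :
    ∃ a : ℂ, ‖a‖ < 1 ∧ μH[(n : ℝ) - 2] {w ∈ torus {i : Fin n // i ≠ j} |
      pEval p (insertCoord j a w) = 0 ∧ pEval q (insertCoord j a w) = 0} = 0 := by
  choose A B d hd0 hd using fun i : Fin n => exists_elimination_mvPolynomial hpq i
  obtain ⟨z, hz, hF⟩ := exists_mem_polydisc_pEval_ne_zero
    (F := ∏ i : {i : Fin n // i ≠ j}, MvPolynomial.rename Subtype.val (d i)) (by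
      rw [Finset.prod_ne_zero_iff]
      intro i _ h
      exact hd0 i (MvPolynomial.rename_injective _ Subtype.val_injective (by simpa using h)))
  have hF' : ∀ i : {i : Fin n // i ≠ j}, pEval (MvPolynomial.rename Subtype.val (d i)) z ≠ 0 := by
    intro i
    have : ∏ i : {i : Fin n // i ≠ j}, pEval (MvPolynomial.rename Subtype.val (d i)) z ≠ 0 := by
      simpa only [pEval, map_prod] using hF
    exact Finset.prod_ne_zero_iff.1 this i (Finset.mem_univ i)
  refine ⟨z j, hz j, ?_⟩
  have hn' : (2 : ℝ) ≤ n := by exact_mod_cast hn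
  obtain ⟨Q, hQ⟩ := exists_polynomial_insertCoord j (z j) q
  have hcard : Fintype.card {i : Fin n // i ≠ j} = n - 1 := by simp
  refine hausdorffMeasure_eq_zero_of_elimination (by linarith) ?_ (fun w hw => hw.1)
    (Q := Q) ?_ (fun w hw => by rw [hQ]; exact hw.2.2) fun i => ?_
  · rw [hcard, Nat.cast_sub (by omega)]
    push_cast
    linarith
  · rintro rfl
    have := hQ (deleteCoord j z)
    rw [insertCoord_deleteCoord] at this
    exact hq z hz (by rw [← this]; simp [pEval])
  · obtain ⟨d', hd'⟩ := exists_polynomial_elimination j (z j) i (d i)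
    refine ⟨d', ?_, fun w hw => ?_⟩
    · rintro rfl
      have := hd' (deleteCoord j z)
      rw [insertCoord_deleteCoord] at this
      exact hF' i (by rw [← this]; simp [pEval])
    · rw [hd', ← hd]
      have h1 := hw.2.1
      have h2 := hw.2.2
      simp only [pEval, map_add, map_mul] at h1 h2 ⊢
      rw [h1, h2]; ring

theorem isCompact_torus (ι : Type*) [Fintype ι] : IsCompact (torus ι) := by
  refine Metric.isCompact_of_isClosed_isBounded ?_ ?_
  · simp only [torus, ofPred_forall]
    exact isClosed_iInter fun i => isClosed_eq (by fun_prop) continuous_const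
  · refine (Metric.isBounded_iff_subset_closedBall 0).2 ⟨√(Fintype.card ι), fun z hz => ?_⟩
    rw [mem_closedBall_zero_iff, EuclideanSpace.norm_eq]
    exact Real.sqrt_le_sqrt (by simp [hz _])

theorem isClosed_realZeroSet {ι : Type*} [Fintype ι] (s : Finset (MvPolynomial (ι × Bool) ℝ)) :
    IsClosed (realZeroSet s) := by
  simp only [realZeroSet, ofPred_forall]
  refine isClosed_biInter fun P _ => isClosed_eq ?_ continuous_const
  refine (MvPolynomial.continuous_eval P).comp (continuous_pi fun ib => ?_)
  split
  · exact Complex.continuous_re.comp (by fun_prop)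
  · exact Complex.continuous_im.comp (by fun_prop)

theorem smul_mem_polydisc {n : ℕ} {ζ : EuclideanSpace ℂ (Fin n)} (hζ : ζ ∈ torus (Fin n)) {ρ : ℝ}
    (h0 : 0 ≤ ρ) (h1 : ρ < 1) : (ρ : ℂ) • ζ ∈ polydisc n := by
  intro i
  simpa [hζ i, abs_of_nonneg h0] using h1

theorem pEval_sub_eq_zero_of_mem_closure {n : ℕ} {p q : MvPolynomial (Fin n) ℂ}
    {φ : EuclideanSpace ℂ (Fin n) → ℂ} (h : IsRationalInner n p q φ) {α : ℂ}
    {ζ : EuclideanSpace ℂ (Fin n)} (hζ : ζ ∈ closure (radialFiber φ α)) :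
    pEval (p - MvPolynomial.C α * q) ζ = 0 := by
  have hc : IsClosed {ζ | pEval (p - MvPolynomial.C α * q) ζ = 0} :=
    isClosed_eq (continuous_pEval _) continuous_const
  refine closure_minimal (fun ζ hζ => ?_) hc hζ
  have hray : Tendsto (fun ρ : ℝ => (ρ : ℂ) • ζ) (nhdsWithin 1 (Iio 1)) (nhds ζ) := by
    have : Continuous fun ρ : ℝ => (ρ : ℂ) • ζ := by fun_prop
    simpa using (this.tendsto 1).mono_left nhdsWithin_le_nhds
  have h1 : Tendsto (fun ρ : ℝ => pEval (p - MvPolynomial.C α * q) ((ρ : ℂ) • ζ))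
      (nhdsWithin 1 (Iio 1)) (nhds (pEval (p - MvPolynomial.C α * q) ζ)) :=
    ((continuous_pEval _).tendsto ζ).comp hray
  have h2 : Tendsto (fun ρ : ℝ => pEval q ((ρ : ℂ) • ζ) * (φ ((ρ : ℂ) • ζ) - α))
      (nhdsWithin 1 (Iio 1)) (nhds (pEval q ζ * (α - α))) :=
    (((continuous_pEval _).tendsto ζ).comp hray).mul (hζ.2.sub_const α)
  rw [sub_self, mul_zero] at h2
  refine tendsto_nhds_unique h1 (h2.congr' ?_)
  filter_upwards [Ioo_mem_nhdsLT (show (0 : ℝ) < 1 by norm_num)] with ρ hρ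
  have hz := smul_mem_polydisc hζ.1 hρ.1.le hρ.2
  have hq := h.q_ne_zero _ hz
  rw [h.phi_eq _ hz]
  simp only [pEval, map_sub, map_mul, MvPolynomial.eval_C] at hq ⊢
  field_simp

theorem pEval_insertCoord_eq_zero {n : ℕ} {j : Fin n} {r : MvPolynomial (Fin n) ℂ}
    {v : EuclideanSpace ℂ {i : Fin n // i ≠ j}}
    (h : ∀ b : ℂ, ‖b‖ = 1 → pEval r (insertCoord j b v) = 0) (a : ℂ) :
    pEval r (insertCoord j a v) = 0 := by
  let P : Polynomial ℂ := MvPolynomial.aeval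
    (fun k => if h : k = j then Polynomial.X else Polynomial.C (v ⟨k, h⟩)) r
  have hP : ∀ b, P.eval b = pEval r (insertCoord j b v) := by
    intro b
    unfold pEval
    rw [← Polynomial.coe_aeval_eq_eval, ← MvPolynomial.coe_aeval_eq_eval]
    simp only [RingHom.coe_coe, P]
    rw [← AlgHom.comp_apply, MvPolynomial.comp_aeval]
    congr 2
    ext k
    by_cases h : k = j
    · subst h; simp
    · rw [dif_neg h]; simpa using (insertCoord_coe j b v ⟨k, h⟩).symm
  have h0 : P = 0 := by
    refine Polynomial.eq_zero_of_infinite_isRoot _ (Set.Infinite.mono (s := Metric.sphere (0 : ℂ) 1)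
      (fun b hb => ?_) ?_)
    · show P.eval b = 0
      rw [hP, h b (by simpa using hb)]
    · refine (isPreconnected_sphere (by simp) _ _).infinite_of_nontrivial
        ⟨1, by simp, -1, by simp, ?_⟩
      norm_num
  rw [← hP, h0, Polynomial.eval_zero]

theorem exists_lipschitzOnWith_pEval {ι : Type*} [Fintype ι] (Q : MvPolynomial ι ℂ)
    {s : Set (EuclideanSpace ℂ ι)} (hs : IsCompact s) :
    ∃ L : ℝ, 0 < L ∧ ∀ x ∈ s, ∀ y ∈ s, ‖pEval Q x - pEval Q y‖ ≤ L * ‖x - y‖ := by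
  classical
  have : LocallyLipschitzOn s (pEval Q) := by
    intro x _
    obtain ⟨f', hf, -⟩ := exists_hasStrictFDerivAt_pEval Q x
    obtain ⟨K, u, hu, h⟩ := hf.exists_lipschitzOnWith
    exact ⟨K, u, mem_nhdsWithin_of_mem_nhds hu, h⟩
  obtain ⟨K, hK⟩ := this.exists_lipschitzOnWith_of_compact hs
  refine ⟨K + 1, by positivity, fun x hx y hy => ?_⟩
  have := hK.dist_le_mul x hx y hy
  rw [dist_eq_norm, dist_eq_norm] at this
  nlinarith [norm_nonneg (x - y)]

theorem insertCoord_smul_mem_polydisc {n : ℕ} {j : Fin n} {a : ℂ} (ha : ‖a‖ < 1)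
    {v : EuclideanSpace ℂ {i : Fin n // i ≠ j}} (hv : v ∈ torus {i : Fin n // i ≠ j}) {ρ : ℝ}
    (h0 : 0 ≤ ρ) (h1 : ρ < 1) : insertCoord j a ((ρ : ℂ) • v) ∈ polydisc n := by
  refine (forall_insertCoord (P := fun z => ‖z‖ < 1)).2 ⟨ha, fun k => ?_⟩
  simpa [hv k, abs_of_nonneg h0] using h1

theorem exists_radial_bound {n : ℕ} {p q : MvPolynomial (Fin n) ℂ}
    {φ : EuclideanSpace ℂ (Fin n) → ℂ} (h : IsRationalInner n p q φ) {α : ℂ} (hα : ‖α‖ = 1)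
    {j : Fin n} {a : ℂ} (ha : ‖a‖ < 1) {K : Set (EuclideanSpace ℂ {i : Fin n // i ≠ j})}
    (hK : K ⊆ torus {i : Fin n // i ≠ j}) {η : ℝ} (hη : 0 < η)
    (hKq : ∀ v ∈ K, η ≤ ‖pEval q (insertCoord j a v)‖)
    (hKr : ∀ v ∈ K, pEval (p - MvPolynomial.C α * q) (insertCoord j a v) = 0) :
    ∃ C : ℝ, 0 < C ∧ ∀ v ∈ K, ∀ ρ : ℝ, 0 ≤ ρ → ρ < 1 →
      ‖α - φ (insertCoord j a ((ρ : ℂ) • v))‖ ≤ C * (1 - ρ) := by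
  set B : ℝ := √(Fintype.card {i : Fin n // i ≠ j}) + 1
  have hB0 : 0 < B := by positivity
  have hB : ∀ v ∈ torus {i : Fin n // i ≠ j}, ‖v‖ ≤ B := by
    intro v hv
    rw [EuclideanSpace.norm_eq]
    simp [hv _, B]
  have hs : IsCompact (insertCoord j a '' Metric.closedBall 0 B) :=
    (isCompact_closedBall _ _).image (continuous_insertCoord j a)
  obtain ⟨L, hL0, hL⟩ := exists_lipschitzOnWith_pEval q hs
  obtain ⟨R, hR0, hR⟩ := exists_lipschitzOnWith_pEval (p - MvPolynomial.C α * q) hs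
  have key : ∀ v ∈ K, ∀ ρ : ℝ, 0 ≤ ρ → ρ < 1 →
      ‖pEval q (insertCoord j a v) - pEval q (insertCoord j a ((ρ : ℂ) • v))‖ ≤
        L * (B * (1 - ρ)) ∧
      ‖pEval (p - MvPolynomial.C α * q) (insertCoord j a ((ρ : ℂ) • v))‖ ≤ R * (B * (1 - ρ)) := by
    intro v hv ρ h0 h1
    have hvB := hB v (hK hv)
    have m1 : insertCoord j a v ∈ insertCoord j a '' Metric.closedBall 0 B :=
      ⟨v, by simpa using hvB, rfl⟩
    have m2 : insertCoord j a ((ρ : ℂ) • v) ∈ insertCoord j a '' Metric.closedBall 0 B := by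
      refine ⟨_, ?_, rfl⟩
      rw [mem_closedBall_zero_iff, norm_smul, Complex.norm_real, Real.norm_of_nonneg h0]
      nlinarith [norm_nonneg v]
    have hd : ‖insertCoord j a v - insertCoord j a ((ρ : ℂ) • v)‖ ≤ B * (1 - ρ) := by
      rw [norm_insertCoord_sub, show v - (ρ : ℂ) • v = ((1 - ρ : ℝ) : ℂ) • v by
        push_cast; rw [sub_smul, one_smul], norm_smul, Complex.norm_real,
        Real.norm_of_nonneg (by linarith)]
      nlinarith
    refine ⟨(hL _ m1 _ m2).trans (by gcongr), ?_⟩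
    have := hR _ m1 _ m2
    rw [hKr v hv, zero_sub, norm_neg] at this
    exact this.trans (by gcongr)
  refine ⟨2 * R * B / η + 4 * L * B / η, by positivity, fun v hv ρ h0 h1 => ?_⟩
  obtain ⟨k1, k2⟩ := key v hv ρ h0 h1
  have hz := insertCoord_smul_mem_polydisc ha (hK hv) h0 h1
  have hη1 := hKq v hv
  have h1ρ : 0 < 1 - ρ := by linarith
  set z := insertCoord j a ((ρ : ℂ) • v)
  rcases le_or_gt (L * (B * (1 - ρ))) (η / 2) with hc | hc
  · have hqz : η / 2 ≤ ‖pEval q z‖ := by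
      have := norm_sub_norm_le (pEval q (insertCoord j a v)) (pEval q z)
      linarith
    have hq0 : pEval q z ≠ 0 := h.q_ne_zero _ hz
    have e : ‖α - φ z‖ = ‖pEval (p - MvPolynomial.C α * q) z‖ / ‖pEval q z‖ := by
      rw [norm_sub_rev, h.phi_eq _ hz, ← norm_div]
      congr 1
      simp only [pEval, map_sub, map_mul, MvPolynomial.eval_C] at hq0 ⊢
      field_simp
    rw [e]
    calc _ ≤ R * (B * (1 - ρ)) / (η / 2) := by gcongr
      _ = 2 * R * B / η * (1 - ρ) := by field_simp
      _ ≤ _ := by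
        have : 0 ≤ 4 * L * B / η := by positivity
        nlinarith
  · have h2 : ‖α - φ z‖ ≤ 2 := by
      have := norm_sub_le α (φ z)
      have := h.abs_lt_one z hz
      linarith
    have h3 : 2 ≤ 4 * L * B / η * (1 - ρ) := by
      rw [div_mul_eq_mul_div, le_div_iff₀ hη]
      linarith
    have : 0 ≤ 2 * R * B / η := by positivity
    nlinarith

/-- The geometric consequence of the hypothesis on `V`: a compact piece `K` of `V` of positive measure
and a slice `a` such that `φ(a, ·)` tends to `α` at a linear rate along the radii ending in `K`. -/
theorem exists_compact_radial {n : ℕ} (hn : 2 ≤ n) {p q : MvPolynomial (Fin n) ℂ}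
    {φ : EuclideanSpace ℂ (Fin n) → ℂ} (h : IsRationalInner n p q φ) {α : ℂ} (hα : ‖α‖ = 1)
    {j : Fin n} {V : Set (EuclideanSpace ℂ {i : Fin n // i ≠ j})} (hVc : IsClosed V)
    (hVt : V ⊆ torus {i : Fin n // i ≠ j})
    (hV : 0 < μH[(n : ℝ) - 2] V)
    (hcl : {ζ | ζ ∈ torus (Fin n) ∧ deleteCoord j ζ ∈ V} ⊆ closure (radialFiber φ α)) :
    ∃ (a : ℂ) (K : Set (EuclideanSpace ℂ {i : Fin n // i ≠ j})) (C : ℝ), ‖a‖ < 1 ∧ IsCompact K ∧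
      K ⊆ torus {i : Fin n // i ≠ j} ∧ 0 < μH[(n : ℝ) - 2] K ∧ 0 < C ∧
      ∀ v ∈ K, ∀ ρ : ℝ, 0 ≤ ρ → ρ < 1 →
        ‖α - φ (insertCoord j a ((ρ : ℂ) • v))‖ ≤ C * (1 - ρ) := by
  obtain ⟨a, ha, hnull⟩ := exists_slice_null hn h.coprime h.q_ne_zero j
  have hr : ∀ v ∈ V, pEval (p - MvPolynomial.C α * q) (insertCoord j a v) = 0 := by
    intro v hv
    refine pEval_insertCoord_eq_zero (fun b hb => ?_) a
    refine pEval_sub_eq_zero_of_mem_closure h (hcl ⟨?_, ?_⟩)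
    · exact (forall_insertCoord (P := fun z => ‖z‖ = 1)).2 ⟨hb, hVt hv⟩
    · rwa [deleteCoord_insertCoord]
  let K : ℕ → Set (EuclideanSpace ℂ {i : Fin n // i ≠ j}) := fun k =>
    V ∩ {v | 1 / ((k : ℝ) + 1) ≤ ‖pEval q (insertCoord j a v)‖}
  have hex : ∃ k, 0 < μH[(n : ℝ) - 2] (K k) := by
    by_contra! h0
    refine hV.ne' (measure_mono_null (fun v hv => ?_)
      (measure_union_null hnull (measure_iUnion_null fun k => le_antisymm (h0 k) zero_le)))
    by_cases hq0 : pEval q (insertCoord j a v) = 0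
    · refine Or.inl ⟨hVt hv, ?_, hq0⟩
      have := hr v hv
      simp only [pEval, map_sub, map_mul] at this hq0 ⊢
      rw [hq0] at this
      simpa using this
    · obtain ⟨k, hk⟩ := exists_nat_one_div_lt (norm_pos_iff.2 hq0)
      exact Or.inr (mem_iUnion.2 ⟨k, hv, hk.le⟩)
  obtain ⟨k, hk⟩ := hex
  have hKV : K k ⊆ torus _ := fun v hv => hVt hv.1
  obtain ⟨C, hC0, hC⟩ := exists_radial_bound h hα ha hKV (η := 1 / ((k : ℝ) + 1)) (by positivity)
    (fun v hv => hv.2) (fun v hv => hr v hv.1)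
  refine ⟨a, K k, C, ha, ?_, hKV, hk, hC0, hC⟩
  refine (isCompact_torus _).of_isClosed_subset (hVc.inter ?_) hKV
  exact isClosed_le continuous_const
    (((continuous_pEval q).comp (continuous_insertCoord j a)).norm)

theorem differentiable_pEval {ι : Type*} [Fintype ι] (Q : MvPolynomial ι ℂ) :
    Differentiable ℂ (pEval Q) := by
  classical
  intro w
  obtain ⟨f', hf, -⟩ := exists_hasStrictFDerivAt_pEval Q w
  exact hf.hasFDerivAt.differentiableAt

theorem IsRationalInner.differentiableOn {n : ℕ} {p q : MvPolynomial (Fin n) ℂ}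
    {φ : EuclideanSpace ℂ (Fin n) → ℂ} (h : IsRationalInner n p q φ) :
    DifferentiableOn ℂ φ (polydisc n) :=
  ((differentiable_pEval p).differentiableOn.mul ((differentiable_pEval q).differentiableOn.inv
    h.q_ne_zero)).congr fun z hz => by
      rw [h.phi_eq z hz, div_eq_mul_inv, Pi.mul_apply, Pi.inv_apply]

theorem norm_one_sub_conj_mul_sq_sub (c w : ℂ) :
    ‖1 - (starRingEnd ℂ) c * w‖ ^ 2 - ‖w - c‖ ^ 2 = (1 - ‖c‖ ^ 2) * (1 - ‖w‖ ^ 2) := by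
  simp only [← Complex.normSq_eq_norm_sq, Complex.normSq_apply, Complex.sub_re, Complex.sub_im,
    Complex.one_re, Complex.one_im, Complex.mul_re, Complex.mul_im, Complex.conj_re,
    Complex.conj_im]
  ring

theorem one_sub_norm_le_norm_one_sub_conj_mul {c w : ℂ} (hw : ‖w‖ ≤ 1) :
    1 - ‖c‖ ≤ ‖1 - (starRingEnd ℂ) c * w‖ := by
  have h1 := norm_sub_norm_le (1 : ℂ) ((starRingEnd ℂ) c * w)
  rw [norm_mul, RCLike.norm_conj, norm_one] at h1
  nlinarith [norm_nonneg c]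

theorem one_sub_conj_mul_ne_zero {c w : ℂ} (hc : ‖c‖ < 1) (hw : ‖w‖ ≤ 1) :
    1 - (starRingEnd ℂ) c * w ≠ 0 := by
  have := one_sub_norm_le_norm_one_sub_conj_mul (c := c) hw
  exact norm_pos_iff.1 (by linarith)

/-- A quantitative form of the Schwarz-Pick lemma. -/
theorem one_sub_norm_ge_of_mapsTo_ball {f : ℂ → ℂ} (hd : DifferentiableOn ℂ f (Metric.ball 0 1))
    (hf : ∀ z ∈ Metric.ball (0 : ℂ) 1, ‖f z‖ < 1) {z : ℂ} (hz : ‖z‖ < 1) :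
    (1 - ‖f 0‖) / 4 * (1 - ‖z‖) ≤ 1 - ‖f z‖ := by
  set c := f 0 with hc
  have hc1 : ‖c‖ < 1 := hf 0 (by simp)
  have hden : ∀ w ∈ Metric.ball (0 : ℂ) 1, 1 - (starRingEnd ℂ) c * f w ≠ 0 := fun w hw =>
    one_sub_conj_mul_ne_zero hc1 (hf w hw).le
  have hg := Complex.norm_le_norm_of_mapsTo_ball
    (f := fun w => (f w - c) / (1 - (starRingEnd ℂ) c * f w)) (R := 1) (z := z)
    ((hd.sub_const c).div ((hd.const_mul _).const_sub 1) hden) (fun w hw => by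
      have h1 := norm_one_sub_conj_mul_sq_sub c (f w)
      have h2 := hf w hw
      have h3 := norm_pos_iff.2 (hden w hw)
      have h4 : 0 < (1 - ‖c‖ ^ 2) * (1 - ‖f w‖ ^ 2) := by
        apply mul_pos <;> nlinarith [norm_nonneg c, norm_nonneg (f w)]
      rw [mem_closedBall_zero_iff, norm_div, div_le_one h3]
      exact le_of_sq_le_sq (by linarith) h3.le) (by simp [hc]) hz
  have hzb : z ∈ Metric.ball (0 : ℂ) 1 := by simpa using hz
  have h3 := norm_pos_iff.2 (hden z hzb)
  rw [norm_div, div_le_iff₀ h3] at hg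
  have h1 := norm_one_sub_conj_mul_sq_sub c (f z)
  have h2 := one_sub_norm_le_norm_one_sub_conj_mul (c := c) (hf z hzb).le
  set X := ‖1 - (starRingEnd ℂ) c * f z‖
  set r := ‖z‖
  have hr0 : 0 ≤ r := norm_nonneg z
  have hf0 := norm_nonneg (f z)
  have hc0 := norm_nonneg c
  have hfz := hf z hzb
  have h5 : (1 - r ^ 2) * (1 - ‖c‖) ^ 2 ≤ (1 - ‖c‖ ^ 2) * (1 - ‖f z‖ ^ 2) := by
    have a1 : ‖f z - c‖ ^ 2 ≤ (r * X) ^ 2 := by gcongr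
    have a2 : (1 - ‖c‖) ^ 2 ≤ X ^ 2 := by gcongr
    have a3 : 0 ≤ 1 - r ^ 2 := by nlinarith
    nlinarith [mul_le_mul_of_nonneg_left a2 a3]
  have h6 : (1 - r ^ 2) * (1 - ‖c‖) ≤ (1 + ‖c‖) * (1 - ‖f z‖ ^ 2) := by
    have : 0 < 1 - ‖c‖ := by linarith
    rw [← mul_le_mul_iff_left₀ this]
    linarith
  have h7 : (1 - r) * (1 - ‖c‖) ≤ (1 - r ^ 2) * (1 - ‖c‖) :=
    mul_le_mul_of_nonneg_right (by nlinarith) (by linarith)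
  have h8 : (1 + ‖c‖) * (1 - ‖f z‖ ^ 2) ≤ 2 * (2 * (1 - ‖f z‖)) := by
    apply mul_le_mul <;> nlinarith
  linarith

theorem IsRationalInner.one_sub_norm_ge {n : ℕ} {p q : MvPolynomial (Fin n) ℂ}
    {φ : EuclideanSpace ℂ (Fin n) → ℂ} (h : IsRationalInner n p q φ)
    {z : EuclideanSpace ℂ (Fin n)} {ρ : ℝ} (h0 : 0 < ρ) (h1 : ρ < 1) (hz : ∀ i, ‖z i‖ ≤ ρ) :
    (1 - ‖φ 0‖) / 4 * (1 - ρ) ≤ 1 - ‖φ z‖ := by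
  have hm : ∀ w ∈ Metric.ball (0 : ℂ) 1, (w / ρ) • z ∈ polydisc n := by
    intro w hw i
    have hw' : ‖w‖ < 1 := by simpa using hw
    rw [PiLp.smul_apply, smul_eq_mul, norm_mul, norm_div, Complex.norm_real,
      Real.norm_of_nonneg h0.le, div_mul_eq_mul_div, div_lt_one h0]
    nlinarith [hz i, norm_nonneg w, norm_nonneg (z i)]
  have := one_sub_norm_ge_of_mapsTo_ball (f := fun w => φ ((w / ρ) • z)) (z := (ρ : ℂ))
    (h.differentiableOn.comp (by fun_prop) hm) (fun w hw => h.abs_lt_one _ (hm w hw))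
    (by rwa [Complex.norm_real, Real.norm_of_nonneg h0.le])
  have hρ : (ρ : ℂ) ≠ 0 := by exact_mod_cast h0.ne'
  simpa [Complex.norm_real, abs_of_nonneg h0.le, hρ] using this

/-- The Poisson kernel of the disc. -/
def poisson (z ζ : ℂ) : ℝ := (1 - ‖z‖ ^ 2) / ‖ζ - z‖ ^ 2

theorem poisson_nonneg {z : ℂ} (hz : ‖z‖ ≤ 1) (ζ : ℂ) : 0 ≤ poisson z ζ := by
  have : ‖z‖ ^ 2 ≤ 1 := by nlinarith [norm_nonneg z]
  exact div_nonneg (by linarith) (by positivity)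

theorem poisson_le {z ζ : ℂ} (hz : ‖z‖ < 1) (hζ : ‖ζ‖ = 1) : poisson z ζ ≤ 2 / (1 - ‖z‖) := by
  have h1 : 1 - ‖z‖ ≤ ‖ζ - z‖ := by simpa [hζ] using norm_sub_norm_le ζ z
  have h2 : 0 < 1 - ‖z‖ := by linarith
  have h0 := norm_nonneg z
  calc poisson z ζ ≤ (1 - ‖z‖ ^ 2) / (1 - ‖z‖) ^ 2 := by
        unfold poisson
        have : 0 ≤ 1 - ‖z‖ ^ 2 := by nlinarith
        gcongr
    _ = (1 + ‖z‖) / (1 - ‖z‖) := by field_simp; ring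
    _ ≤ _ := by gcongr; linarith

theorem poisson_radial_le {v ζ : ℂ} (hv : ‖v‖ = 1) (hζ : ‖ζ‖ = 1) {δ M : ℝ} (hδ : 0 < δ)
    (hM : 2 ≤ M) (hMδ : M * δ ≤ 1) (h : M * δ < ‖ζ - v‖) :
    poisson ((1 - δ : ℝ) * v) ζ ≤ 32 / M * poisson ((1 - M * δ : ℝ) * v) ζ := by
  set t := ‖ζ - v‖ with ht
  have hδ1 : δ ≤ 1 := by nlinarith
  have hMδ0 : 0 < M * δ := by positivity
  have ht0 : 0 < t := by linarith
  have n1 : ‖((1 - δ : ℝ) : ℂ) * v‖ = 1 - δ := by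
    rw [norm_mul, hv, Complex.norm_real, Real.norm_of_nonneg (by linarith), mul_one]
  have n2 : ‖((1 - M * δ : ℝ) : ℂ) * v‖ = 1 - M * δ := by
    rw [norm_mul, hv, Complex.norm_real, Real.norm_of_nonneg (by linarith), mul_one]
  have d1 : t / 2 ≤ ‖ζ - ((1 - δ : ℝ) : ℂ) * v‖ := by
    have e : ζ - ((1 - δ : ℝ) : ℂ) * v = (ζ - v) + (δ : ℂ) * v := by push_cast; ring
    have := norm_sub_le_norm_add (ζ - v) ((δ : ℂ) * v)
    rw [norm_mul, hv, Complex.norm_real, Real.norm_of_nonneg hδ.le, ← ht] at this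
    rw [e]
    nlinarith
  have d2 : ‖ζ - ((1 - M * δ : ℝ) : ℂ) * v‖ ≤ 2 * t := by
    have e : ζ - ((1 - M * δ : ℝ) : ℂ) * v = (ζ - v) + ((M * δ : ℝ) : ℂ) * v := by push_cast; ring
    have := norm_add_le (ζ - v) (((M * δ : ℝ) : ℂ) * v)
    rw [norm_mul, hv, Complex.norm_real, Real.norm_of_nonneg hMδ0.le, ← ht] at this
    rw [e]
    nlinarith
  have d3 : 0 < ‖ζ - ((1 - M * δ : ℝ) : ℂ) * v‖ := by
    have := norm_sub_norm_le ζ (((1 - M * δ : ℝ) : ℂ) * v)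
    rw [n2, hζ] at this
    linarith
  have p1 : poisson ((1 - δ : ℝ) * v) ζ ≤ 2 * δ / (t / 2) ^ 2 := by
    unfold poisson
    rw [n1]
    gcongr
    nlinarith
  have p2 : M * δ / (2 * t) ^ 2 ≤ poisson ((1 - M * δ : ℝ) * v) ζ := by
    unfold poisson
    rw [n2]
    have hac : M * δ ≤ 1 - (1 - M * δ) ^ 2 := by
      nlinarith [mul_nonneg hMδ0.le (sub_nonneg.2 hMδ)]
    have hnn : 0 ≤ 1 - (1 - M * δ) ^ 2 := hMδ0.le.trans hac
    gcongr
  calc _ ≤ _ := p1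
    _ = 32 / M * (M * δ / (2 * t) ^ 2) := by field_simp; norm_num
    _ ≤ _ := by gcongr

theorem prod_poisson_le {ι : Type*} [Fintype ι] [DecidableEq ι] {v ζ : ι → ℂ} (hv : ∀ k, ‖v k‖ = 1)
    (hζ : ∀ k, ‖ζ k‖ = 1) {δ M : ℝ} (hδ : 0 < δ) (hM : 2 ≤ M) (hMδ : M * δ ≤ 1) :
    ∏ k, poisson ((1 - δ : ℝ) * v k) (ζ k) ≤
      (if ∀ k, ‖ζ k - v k‖ ≤ M * δ then (2 / δ) ^ Fintype.card ι else 0) +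
        ∑ i, 32 / M * ∏ k, poisson ((if k = i then 1 - M * δ else 1 - δ : ℝ) * v k) (ζ k) := by
  have hδ1 : δ ≤ 1 := by nlinarith
  have hMδ0 : 0 < M * δ := by positivity
  have nn : ∀ s : ℝ, 0 ≤ s → s ≤ 1 → ∀ k, 0 ≤ poisson (s * v k) (ζ k) := by
    intro s h0 h1 k
    refine poisson_nonneg ?_ _
    rwa [norm_mul, hv, Complex.norm_real, Real.norm_of_nonneg h0, mul_one]
  have nn' : ∀ i k, 0 ≤ poisson ((if k = i then 1 - M * δ else 1 - δ : ℝ) * v k) (ζ k) := by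
    intro i k
    split_ifs
    · exact nn _ (by linarith) (by linarith) k
    · exact nn _ (by linarith) (by linarith) k
  have nn1 := nn (1 - δ) (by linarith) (by linarith)
  have hsum : ∀ i ∈ Finset.univ, 0 ≤
      32 / M * ∏ k, poisson ((if k = i then 1 - M * δ else 1 - δ : ℝ) * v k) (ζ k) := fun i _ =>
    mul_nonneg (by positivity) (Finset.prod_nonneg fun k _ => nn' i k)
  split_ifs with h
  · refine le_add_of_le_of_nonneg ?_ (Finset.sum_nonneg hsum)
    rw [← Finset.card_univ, ← Finset.prod_const]
    refine Finset.prod_le_prod (fun k _ => nn1 k) fun k _ => ?_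
    have n1 : ‖((1 - δ : ℝ) : ℂ) * v k‖ = 1 - δ := by
      rw [norm_mul, hv, Complex.norm_real, Real.norm_of_nonneg (by linarith), mul_one]
    have := poisson_le (z := (1 - δ : ℝ) * v k) (by rw [n1]; linarith) (hζ k)
    rwa [n1, sub_sub_cancel] at this
  · push Not at h
    obtain ⟨i, hi⟩ := h
    rw [zero_add]
    refine le_trans ?_ (Finset.single_le_sum hsum (Finset.mem_univ i))
    rw [← Finset.mul_prod_erase _ _ (Finset.mem_univ i), ← Finset.mul_prod_erase _
      (fun k => poisson ((if k = i then 1 - M * δ else 1 - δ : ℝ) * v k) (ζ k)) (Finset.mem_univ i),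
      if_pos rfl, ← mul_assoc]
    have e : ∏ k ∈ Finset.univ.erase i,
        poisson ((if k = i then 1 - M * δ else 1 - δ : ℝ) * v k) (ζ k) =
        ∏ k ∈ Finset.univ.erase i, poisson ((1 - δ : ℝ) * v k) (ζ k) :=
      Finset.prod_congr rfl fun k hk => by rw [if_neg (Finset.ne_of_mem_erase hk)]
    rw [e]
    exact mul_le_mul_of_nonneg_right (poisson_radial_le (hv i) (hζ i) hδ hM hMδ hi)
      (Finset.prod_nonneg fun k _ => nn1 k)

theorem IsClarkMeasure.lintegral_prod_poisson {n : ℕ} {φ : EuclideanSpace ℂ (Fin n) → ℂ} {α : ℂ}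
    {μ : Measure (EuclideanSpace ℂ (Fin n))} (hμ : IsClarkMeasure n φ α μ)
    {z : EuclideanSpace ℂ (Fin n)} (hz : z ∈ polydisc n) :
    ∫⁻ ζ, ENNReal.ofReal (∏ j, poisson (z j) (ζ j)) ∂μ =
      ENNReal.ofReal ((1 - ‖φ z‖ ^ 2) / ‖α - φ z‖ ^ 2) := hμ.2.2 z hz

theorem IsClarkMeasure.ae_mem_torus {n : ℕ} {φ : EuclideanSpace ℂ (Fin n) → ℂ} {α : ℂ}
    {μ : Measure (EuclideanSpace ℂ (Fin n))} (hμ : IsClarkMeasure n φ α μ) :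
    ∀ᵐ ζ ∂μ, ζ ∈ torus (Fin n) := hμ.2.1

theorem measurable_prod_poisson {ι : Type*} [Fintype ι] (z : EuclideanSpace ℂ ι) :
    Measurable fun ζ : EuclideanSpace ℂ ι => ∏ j, poisson (z j) (ζ j) := by
  refine Finset.measurable_prod _ fun i _ => ?_
  refine Measurable.div measurable_const ?_
  exact (Continuous.measurable (by fun_prop))

theorem IsRationalInner.poisson_integral_le {n : ℕ} {p q : MvPolynomial (Fin n) ℂ}
    {φ : EuclideanSpace ℂ (Fin n) → ℂ} (h : IsRationalInner n p q φ) {α : ℂ} (hα : ‖α‖ = 1)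
    {z : EuclideanSpace ℂ (Fin n)} {δ : ℝ} (h0 : 0 < δ) (h1 : δ < 1) (hz : ∀ i, ‖z i‖ ≤ 1 - δ) :
    (1 - ‖φ z‖ ^ 2) / ‖α - φ z‖ ^ 2 ≤ 8 / (1 - ‖φ 0‖) / δ := by
  have hzp : z ∈ polydisc n := fun i => (hz i).trans_lt (by linarith)
  have h2 := h.one_sub_norm_ge (by linarith) (by linarith) hz
  rw [sub_sub_cancel] at h2
  have h3 : 0 < 1 - ‖φ 0‖ := by
    have := h.abs_lt_one 0 (fun i => by simp)
    linarith
  have h4 := h.abs_lt_one z hzp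
  have h5 := poisson_le h4 hα
  refine h5.trans ?_
  rw [div_div, div_le_div_iff₀ (by linarith) (by positivity)]
  linarith

theorem IsRationalInner.le_poisson_integral {n : ℕ} {p q : MvPolynomial (Fin n) ℂ}
    {φ : EuclideanSpace ℂ (Fin n) → ℂ} (h : IsRationalInner n p q φ) {α : ℂ} (hα : ‖α‖ = 1)
    {z : EuclideanSpace ℂ (Fin n)} {δ C : ℝ} (h0 : 0 < δ) (h1 : δ < 1) (hz : ∀ i, ‖z i‖ ≤ 1 - δ)
    (hC : 0 < C) (hr : ‖α - φ z‖ ≤ C * δ) :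
    (1 - ‖φ 0‖) / (4 * C ^ 2) / δ ≤ (1 - ‖φ z‖ ^ 2) / ‖α - φ z‖ ^ 2 := by
  have hzp : z ∈ polydisc n := fun i => (hz i).trans_lt (by linarith)
  have h2 := h.one_sub_norm_ge (by linarith) (by linarith) hz
  rw [sub_sub_cancel] at h2
  have h4 := h.abs_lt_one z hzp
  have h5 : 0 < ‖α - φ z‖ := by
    have := norm_sub_norm_le α (φ z)
    linarith
  calc (1 - ‖φ 0‖) / (4 * C ^ 2) / δ = ((1 - ‖φ 0‖) / 4 * δ) / (C * δ) ^ 2 := by field_simp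
    _ ≤ (1 - ‖φ z‖ ^ 2) / (C * δ) ^ 2 := by
      gcongr
      nlinarith [norm_nonneg (φ z)]
    _ ≤ _ := by
      have : 0 ≤ 1 - ‖φ z‖ ^ 2 := by nlinarith [norm_nonneg (φ z)]
      gcongr

theorem dist_le_of_forall_norm_sub_le {ι : Type*} [Fintype ι] {x y : EuclideanSpace ℂ ι} {r : ℝ}
    (hr : 0 ≤ r) (h : ∀ k, ‖x k - y k‖ ≤ r) : dist x y ≤ (Fintype.card ι) * r := by
  rw [dist_eq_norm, EuclideanSpace.norm_eq]
  refine Real.sqrt_le_iff.2 ⟨by positivity, ?_⟩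
  calc ∑ i, ‖(x - y) i‖ ^ 2 ≤ ∑ _i : ι, r ^ 2 := by
        gcongr with i
        exact h i
    _ = Fintype.card ι * r ^ 2 := by simp
    _ ≤ _ := by
      rw [mul_pow]
      gcongr
      rcases Nat.eq_zero_or_pos (Fintype.card ι) with h0 | h0
      · simp [h0]
      · have : (1 : ℝ) ≤ Fintype.card ι := by exact_mod_cast h0
        nlinarith

/-- The lower density bound for the projected Clark measure on `K`. -/
theorem exists_density_bound {n : ℕ} (hn : 2 ≤ n) {p q : MvPolynomial (Fin n) ℂ}
    {φ : EuclideanSpace ℂ (Fin n) → ℂ} (h : IsRationalInner n p q φ) {α : ℂ} (hα : ‖α‖ = 1)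
    {μ : Measure (EuclideanSpace ℂ (Fin n))} (hμ : IsClarkMeasure n φ α μ)
    {j : Fin n} {a : ℂ} (ha : ‖a‖ < 1) {K : Set (EuclideanSpace ℂ {i : Fin n // i ≠ j})}
    (hK : K ⊆ torus {i : Fin n // i ≠ j}) {C : ℝ} (hC : 0 < C)
    (hKC : ∀ v ∈ K, ∀ ρ : ℝ, 0 ≤ ρ → ρ < 1 →
        ‖α - φ (insertCoord j a ((ρ : ℂ) • v))‖ ≤ C * (1 - ρ)) :
    ∃ c r₀ : ℝ, 0 < c ∧ 0 < r₀ ∧ ∀ v ∈ K, ∀ r, 0 < r → r < r₀ →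
      ENNReal.ofReal (c * r ^ (n - 2)) ≤ μ (deleteCoord j ⁻¹' Metric.closedBall v r) := by
  have := hμ.1
  set N : ℕ := Fintype.card {i : Fin n // i ≠ j} with hN
  have hNn : N = n - 1 := by simp [hN]
  have hN1 : 1 ≤ N := by omega
  have hN1' : (1 : ℝ) ≤ N := by exact_mod_cast hN1
  have h3 : 0 < 1 - ‖φ 0‖ := by
    have := h.abs_lt_one 0 (fun i => by simp)
    linarith
  set U := 8 / (1 - ‖φ 0‖) with hU
  set l := (1 - ‖φ 0‖) / (4 * C ^ 2) with hl
  set A := 2 / (1 - ‖a‖) with hA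
  have ha' : 0 < 1 - ‖a‖ := by linarith
  have hU0 : 0 < U := by positivity
  have hl0 : 0 < l := by positivity
  have hA0 : 0 < A := by positivity
  set M := 2 + N * 64 * U / l with hM
  have hM2 : 2 ≤ M := by
    have : 0 ≤ N * 64 * U / l := by positivity
    linarith
  have hMU : N * (32 / M * U) ≤ l / 2 := by
    rw [div_mul_eq_mul_div, mul_div_assoc', div_le_div_iff₀ (by linarith) (by norm_num)]
    rw [hM, mul_add, mul_div_cancel₀ _ hl0.ne']
    nlinarith
  refine ⟨l / (2 * A * 2 ^ N) / (N * M) ^ (n - 2), N * M * min (1 - ‖a‖) (1 / M),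
    by positivity, by positivity, fun v hv r hr0 hr => ?_⟩
  set δ := r / (N * M) with hδ
  have hNM : 0 < N * M := by positivity
  have hδ0 : 0 < δ := by positivity
  have hrδ : r = N * (M * δ) := by rw [hδ]; field_simp
  have hδmin : δ < min (1 - ‖a‖) (1 / M) := by rwa [hδ, div_lt_iff₀' hNM]
  have hδa : δ < 1 - ‖a‖ := hδmin.trans_le (min_le_left _ _)
  have hMδ : M * δ ≤ 1 := by
    have := (hδmin.trans_le (min_le_right _ _)).le
    rwa [le_div_iff₀' (by linarith)] at this
  have hδ1 : δ < 1 := by linarith [norm_nonneg a]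
  have hδM : δ ≤ M * δ := by nlinarith
  have hvt := hK hv
  let s : {i : Fin n // i ≠ j} → {i : Fin n // i ≠ j} → ℝ := fun i k =>
    if k = i then 1 - M * δ else 1 - δ
  have hs : ∀ i k, 0 ≤ s i k ∧ s i k ≤ 1 - δ := by
    intro i k
    simp only [s]
    split_ifs <;> constructor <;> linarith
  let w : {i : Fin n // i ≠ j} → EuclideanSpace ℂ {i : Fin n // i ≠ j} := fun i =>
    WithLp.toLp 2 fun k => (s i k : ℂ) * v k
  let z := insertCoord j a (((1 - δ : ℝ) : ℂ) • v)
  have hz : ∀ i, ‖z i‖ ≤ 1 - δ := by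
    refine (forall_insertCoord (P := fun z => ‖z‖ ≤ 1 - δ)).2 ⟨by linarith, fun k => ?_⟩
    rw [PiLp.smul_apply, smul_eq_mul, norm_mul, hvt k, Complex.norm_real,
      Real.norm_of_nonneg (by linarith), mul_one]
  have hw : ∀ i k, ‖insertCoord j a (w i) k‖ ≤ 1 - δ := by
    intro i
    refine (forall_insertCoord (P := fun z => ‖z‖ ≤ 1 - δ)).2 ⟨by linarith, fun k => ?_⟩
    rw [PiLp.toLp_apply, norm_mul, hvt k, Complex.norm_real,
      Real.norm_of_nonneg (hs i k).1, mul_one]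
    exact (hs i k).2
  have hpd : ∀ z : EuclideanSpace ℂ (Fin n), (∀ i, ‖z i‖ ≤ 1 - δ) → z ∈ polydisc n :=
    fun z hz i => (hz i).trans_lt (by linarith)
  set S : Set (EuclideanSpace ℂ (Fin n)) := deleteCoord j ⁻¹' Metric.closedBall v r with hS
  have hSm : MeasurableSet S :=
    (Metric.isClosed_closedBall.preimage (continuous_deleteCoord j)).measurableSet
  have hpt : ∀ ζ ∈ torus (Fin n), ∏ i, poisson (z i) (ζ i) ≤
      S.indicator (fun _ => A * (2 / δ) ^ N) ζ +
        ∑ i, 32 / M * ∏ k, poisson (insertCoord j a (w i) k) (ζ k) := by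
    intro ζ hζ
    have hprod := prod_poisson_le (v := fun k => v k) (ζ := fun k => deleteCoord j ζ k) hvt
      (fun k => hζ k) hδ0 hM2 hMδ
    have ha0 := poisson_nonneg ha.le (ζ j)
    have haA : poisson a (ζ j) ≤ A := poisson_le ha (hζ j)
    simp only [Fintype.prod_eq_mul_prod_subtype_ne _ j]
    simp only [z, insertCoord_self, insertCoord_coe, PiLp.smul_apply, smul_eq_mul]
    refine (mul_le_mul_of_nonneg_left hprod ha0).trans ?_
    rw [mul_add, Finset.mul_sum]
    refine add_le_add ?_ (le_of_eq ?_)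
    · split_ifs with hc
      · have : ζ ∈ S := by
          rw [hS, mem_preimage, Metric.mem_closedBall, hrδ]
          exact dist_le_of_forall_norm_sub_le (by positivity) hc
        rw [indicator_of_mem this]
        gcongr
      · rw [mul_zero]
        exact indicator_nonneg (fun _ _ => by positivity) _
    · refine Finset.sum_congr rfl fun i _ => ?_
      simp only [w, s, deleteCoord_apply]
      ring
  have hinteg : ENNReal.ofReal ((1 - ‖φ z‖ ^ 2) / ‖α - φ z‖ ^ 2) ≤
      ENNReal.ofReal (A * (2 / δ) ^ N) * μ S + ∑ i : {i : Fin n // i ≠ j},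
        ENNReal.ofReal (32 / M) * ENNReal.ofReal (U / δ) := by
    rw [← hμ.lintegral_prod_poisson (hpd z hz)]
    calc _ ≤ ∫⁻ ζ, (S.indicator (fun _ => ENNReal.ofReal (A * (2 / δ) ^ N)) ζ +
          ∑ i, ENNReal.ofReal (32 / M) *
            ENNReal.ofReal (∏ k, poisson (insertCoord j a (w i) k) (ζ k))) ∂μ := by
          refine lintegral_mono_ae ?_
          filter_upwards [hμ.ae_mem_torus] with ζ hζ
          refine (ENNReal.ofReal_le_ofReal (hpt ζ hζ)).trans ?_
          refine ENNReal.ofReal_add_le.trans (add_le_add (le_of_eq ?_) ?_)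
          · by_cases hc : ζ ∈ S <;> simp [hc]
          · refine (ENNReal.ofReal_sum_of_nonneg fun i _ => ?_).trans_le
              (Finset.sum_le_sum fun i _ => (ENNReal.ofReal_mul (by positivity)).le)
            refine mul_nonneg (by positivity) (Finset.prod_nonneg fun k _ => ?_)
            exact poisson_nonneg ((hw i k).trans (by linarith)) _
      _ = ENNReal.ofReal (A * (2 / δ) ^ N) * μ S + ∑ i, ENNReal.ofReal (32 / M) *
            ∫⁻ ζ, ENNReal.ofReal (∏ k, poisson (insertCoord j a (w i) k) (ζ k)) ∂μ := by
          rw [lintegral_add_left (measurable_const.indicator hSm), lintegral_indicator_const hSm,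
            lintegral_finsetSum _ fun i _ =>
              (measurable_prod_poisson _).ennreal_ofReal.const_mul _]
          congr 1
          exact Finset.sum_congr rfl fun i _ =>
            lintegral_const_mul _ (measurable_prod_poisson _).ennreal_ofReal
      _ ≤ _ := by
          gcongr with i
          rw [hμ.lintegral_prod_poisson (hpd _ (hw i))]
          exact ENNReal.ofReal_le_ofReal (h.poisson_integral_le hα hδ0 hδ1 (hw i))
  have hlow : l / δ ≤ (1 - ‖φ z‖ ^ 2) / ‖α - φ z‖ ^ 2 :=
    h.le_poisson_integral hα hδ0 hδ1 hz hC
      (by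
        have := hKC v hv (1 - δ) (by linarith) (by linarith)
        rwa [sub_sub_cancel] at this)
  have hfin := (ENNReal.ofReal_le_ofReal hlow).trans hinteg
  have hreal : l / δ ≤ A * (2 / δ) ^ N * μ.real S + N * (32 / M * (U / δ)) := by
    rw [← ENNReal.ofReal_toReal (measure_ne_top μ S), Finset.sum_const, nsmul_eq_mul,
      Finset.card_univ, ← hN, ← ENNReal.ofReal_mul (by positivity),
      ← ENNReal.ofReal_mul (by positivity), ← ENNReal.ofReal_natCast,
      ← ENNReal.ofReal_mul (by positivity),
      ← ENNReal.ofReal_add (by positivity) (by positivity)] at hfin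
    exact (ENNReal.ofReal_le_ofReal_iff (by positivity)).1 hfin
  have hreal2 : l / 2 / δ ≤ A * (2 / δ) ^ N * μ.real S := by
    have : N * (32 / M * (U / δ)) ≤ l / 2 / δ := by
      calc N * (32 / M * (U / δ)) = N * (32 / M * U) / δ := by ring
        _ ≤ _ := by gcongr
    have e : l / δ = l / 2 / δ + l / 2 / δ := by ring
    linarith
  rw [← ENNReal.ofReal_toReal (measure_ne_top μ S)]
  refine ENNReal.ofReal_le_ofReal ?_
  change _ ≤ μ.real S
  rw [div_mul_eq_mul_div, mul_div_assoc, ← div_pow, ← hδ]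
  have e2 : δ ^ N = δ ^ (n - 2) * δ := by rw [← pow_succ]; congr 1; omega
  rw [div_pow, e2] at hreal2
  rw [div_mul_eq_mul_div, div_le_iff₀ (by positivity)]
  rw [div_le_iff₀ hδ0] at hreal2
  have e3 : A * (2 ^ N / (δ ^ (n - 2) * δ)) * μ.real S * δ =
      A * 2 ^ N * μ.real S / δ ^ (n - 2) := by
    field_simp
  rw [e3, le_div_iff₀ (by positivity)] at hreal2
  linarith

/-- If a measure has positive lower `m`-density, uniformly on a compact null set `K`, then `K` is
`ℋ^m`-null. -/
theorem hausdorffMeasure_eq_zero_of_density {X : Type*} [MetricSpace X] [ProperSpace X]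
    [MeasurableSpace X] [BorelSpace X] {ν : Measure X} [IsFiniteMeasure ν] {K : Set X}
    (hK : IsCompact K) (m : ℕ) {c r₀ : ℝ} (hc : 0 < c) (hr₀ : 0 < r₀)
    (h : ∀ v ∈ K, ∀ r, 0 < r → r < r₀ → ENNReal.ofReal (c * r ^ m) ≤ ν (Metric.closedBall v r))
    (h0 : ν K = 0) : μH[(m : ℝ)] K = 0 := by
  set r : ℕ → ℝ := fun k => r₀ / (k + 2) with hr
  have hrpos : ∀ k, 0 < r k := fun k => by positivity
  have hrlt : ∀ k, r k < r₀ := fun k => by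
    have : (0 : ℝ) ≤ k := k.cast_nonneg
    exact div_lt_self hr₀ (by linarith)
  have hr0 : Tendsto r atTop (nhds 0) :=
    tendsto_const_nhds.div_atTop (tendsto_atTop_add_const_right _ _ tendsto_natCast_atTop_atTop)
  have hu : ∀ k, ∃ u ⊆ K, (u.PairwiseDisjoint fun a => Metric.closedBall a (r k)) ∧
      ∀ a ∈ K, ∃ b ∈ u, Metric.closedBall a (r k) ⊆ Metric.closedBall b (4 * r k) := fun k =>
    Vitali.exists_disjoint_subfamily_covering_enlargement_closedBall K (fun x => x)
      (fun _ => r k) (r k) (fun _ _ => le_rfl) 4 (by norm_num)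
  choose u huK hud hcov using hu
  have hcount : ∀ k, (u k).Countable := fun k =>
    (hud k).countable_of_nonempty_interior fun x _ =>
      ⟨x, Metric.ball_subset_interior_closedBall (Metric.mem_ball_self (hrpos k))⟩
  have : ∀ k, Countable (u k) := fun k => (hcount k).to_subtype
  have hdiam : ∀ k (i : u k), Metric.ediam (Metric.closedBall (i : X) (4 * r k)) ≤
      ENNReal.ofReal (8 * r k) := fun k i => by
    refine Metric.ediam_le_of_forall_dist_le fun x hx y hy => ?_
    have := dist_triangle_right x y (i : X)
    rw [Metric.mem_closedBall] at hx hy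
    linarith
  have hb : μH[(m : ℝ)] K ≤ liminf (fun k => ∑' i : u k,
      Metric.ediam (Metric.closedBall (i : X) (4 * r k)) ^ (m : ℝ)) atTop := by
    refine Measure.hausdorffMeasure_le_liminf_tsum (m : ℝ) K (fun k => ENNReal.ofReal (8 * r k)) ?_
      (fun k (i : u k) => Metric.closedBall (i : X) (4 * r k)) (Eventually.of_forall hdiam)
      (Eventually.of_forall fun k v hv => ?_)
    · simpa using ENNReal.tendsto_ofReal (hr0.const_mul 8)
    · obtain ⟨b, hb, hsub⟩ := hcov k v hv
      exact mem_iUnion.2 ⟨⟨b, hb⟩, hsub (Metric.mem_closedBall_self (hrpos k).le)⟩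
  have hsum : ∀ k, ∑' i : u k, Metric.ediam (Metric.closedBall (i : X) (4 * r k)) ^ (m : ℝ) ≤
      ENNReal.ofReal (8 ^ m / c) * ν (Metric.cthickening (r k) K) := fun k => by
    calc _ ≤ ∑' i : u k, ENNReal.ofReal (8 ^ m / c) * ν (Metric.closedBall (i : X) (r k)) := by
          refine ENNReal.tsum_le_tsum fun i => ?_
          rw [ENNReal.rpow_natCast]
          calc _ ≤ ENNReal.ofReal (8 * r k) ^ m := by gcongr; exact hdiam k i
            _ = ENNReal.ofReal (8 ^ m / c) * ENNReal.ofReal (c * r k ^ m) := by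
              rw [← ENNReal.ofReal_pow (by have := hrpos k; positivity),
                ← ENNReal.ofReal_mul (by positivity)]
              congr 1
              rw [mul_pow]
              field_simp
            _ ≤ _ := by
              gcongr
              exact h i (huK k i.2) _ (hrpos k) (hrlt k)
      _ = ENNReal.ofReal (8 ^ m / c) * ν (⋃ i : u k, Metric.closedBall (i : X) (r k)) := by
          rw [ENNReal.tsum_mul_left, measure_iUnion]
          · exact fun a b hab => hud k a.2 b.2 (Subtype.coe_injective.ne hab)
          · exact fun i => Metric.isClosed_closedBall.measurableSet
      _ ≤ _ := by
          gcongr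
          exact iUnion_subset fun i => Metric.closedBall_subset_cthickening (huK k i.2) _
  have hlim : Tendsto (fun k => ENNReal.ofReal (8 ^ m / c) * ν (Metric.cthickening (r k) K)) atTop
      (nhds 0) := by
    have := ENNReal.Tendsto.const_mul (a := ENNReal.ofReal (8 ^ m / c))
      ((tendsto_measure_cthickening_of_isCompact (μ := ν) hK).comp hr0)
        (Or.inr ENNReal.ofReal_ne_top)
    simpa [h0] using this
  refine le_antisymm (hb.trans ?_) bot_le
  rw [← hlim.liminf_eq]
  exact liminf_le_liminf (Eventually.of_forall hsum)

/-- A cylinder over a set of positive measure carries positive Clark mass. -/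
theorem cylinder_measure_pos {n : ℕ} (hn : 2 ≤ n) {p q : MvPolynomial (Fin n) ℂ}
    {φ : EuclideanSpace ℂ (Fin n) → ℂ} (h : IsRationalInner n p q φ) {α : ℂ} (hα : ‖α‖ = 1)
    {μ : Measure (EuclideanSpace ℂ (Fin n))} (hμ : IsClarkMeasure n φ α μ)
    {j : Fin n} {a : ℂ} (ha : ‖a‖ < 1) {K : Set (EuclideanSpace ℂ {i : Fin n // i ≠ j})}
    (hKc : IsCompact K) (hK : K ⊆ torus {i : Fin n // i ≠ j}) (hpos : 0 < μH[(n : ℝ) - 2] K)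
    {C : ℝ} (hC : 0 < C)
    (hKC : ∀ v ∈ K, ∀ ρ : ℝ, 0 ≤ ρ → ρ < 1 →
        ‖α - φ (insertCoord j a ((ρ : ℂ) • v))‖ ≤ C * (1 - ρ)) :
    0 < μ (deleteCoord j ⁻¹' K) := by
  have := hμ.1
  obtain ⟨c, r₀, hc, hr₀, hd⟩ := exists_density_bound hn h hα hμ ha hK hC hKC
  have hm : Measurable (deleteCoord j) := (continuous_deleteCoord j).measurable
  rw [pos_iff_ne_zero]
  intro h0
  have e : (n : ℝ) - 2 = ((n - 2 : ℕ) : ℝ) := by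
    rw [Nat.cast_sub hn]
    norm_num
  rw [e] at hpos
  refine hpos.ne' (hausdorffMeasure_eq_zero_of_density (ν := μ.map (deleteCoord j)) hKc (n - 2) hc
    hr₀ (fun v hv r hr hrr => ?_) ?_)
  · rw [Measure.map_apply hm Metric.isClosed_closedBall.measurableSet]
    exact hd v hv r hr hrr
  · rwa [Measure.map_apply hm hKc.isClosed.measurableSet]

theorem integral_comp_toCircle (f : ℂ → ℂ) :
    ∫ t : UnitAddCircle, f (AddCircle.toCircle t) = Real.circleAverage f 0 1 := by
  rw [← UnitAddCircle.intervalIntegral_preimage 0, zero_add, Real.circleAverage_def]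
  have e : ∀ a : ℝ, f (AddCircle.toCircle (a : UnitAddCircle)) =
      (fun θ => f (circleMap 0 1 θ)) (2 * Real.pi * a) := fun a => by
    simp [AddCircle.toCircle_apply_mk, circleMap]
  simp_rw [e]
  rw [intervalIntegral.integral_comp_mul_left (fun θ => f (circleMap 0 1 θ)) (by positivity)]
  simp

theorem integral_comp_toCircle_of_diffContOnCl {f : ℂ → ℂ}
    (hf : DiffContOnCl ℂ f (Metric.ball 0 1)) :
    ∫ t : UnitAddCircle, f (AddCircle.toCircle t) = f 0 := by
  rw [integral_comp_toCircle]
  exact DiffContOnCl.circleAverage (by simpa using hf)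

theorem integral_poisson_mul {f : ℂ → ℂ} (hf : DiffContOnCl ℂ f (Metric.ball 0 1)) {z : ℂ}
    (hz : ‖z‖ < 1) :
    ∫ t : UnitAddCircle, (poisson z (AddCircle.toCircle t) : ℂ) * f (AddCircle.toCircle t) =
      f z := by
  rw [integral_comp_toCircle (fun w => (poisson z w : ℂ) * f w),
    ← hf.circleAverage_poissonKernel_smul' (w := z) (by simpa using hz)]
  refine Real.circleAverage_congr_sphere fun w hw => ?_
  have : ‖w‖ = 1 := by simpa using hw
  simp [poisson, this]

/-- The harmonic extension to the disc of the character `ζ ↦ ζ^k`. -/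
def harmonicPow (k : ℤ) (z : ℂ) : ℂ :=
  if 0 ≤ k then z ^ k.toNat else (starRingEnd ℂ) z ^ (-k).toNat

theorem continuous_harmonicPow (k : ℤ) : Continuous (harmonicPow k) := by
  unfold harmonicPow
  split_ifs <;> fun_prop

theorem harmonicPow_toCircle (k : ℤ) (t : UnitAddCircle) :
    harmonicPow k (AddCircle.toCircle t) = fourier k t := by
  unfold harmonicPow
  split_ifs with h
  · obtain ⟨m, rfl⟩ := Int.eq_ofNat_of_zero_le h
    simp [fourier_apply, AddCircle.toCircle_nsmul]
  · obtain ⟨m, hm⟩ := Int.eq_ofNat_of_zero_le (show 0 ≤ -k by omega)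
    obtain rfl : k = -m := by omega
    rw [fourier_neg]
    simp [fourier_apply, AddCircle.toCircle_nsmul]

theorem integral_poisson_mul_fourier (k : ℤ) {z : ℂ} (hz : ‖z‖ < 1) :
    ∫ t : UnitAddCircle, (poisson z (AddCircle.toCircle t) : ℂ) * fourier k t =
      harmonicPow k z := by
  simp_rw [← harmonicPow_toCircle]
  unfold harmonicPow
  split_ifs with h
  · exact integral_poisson_mul (f := fun z => z ^ k.toNat)
      (Differentiable.diffContOnCl (by fun_prop)) hz
  · have := congrArg (starRingEnd ℂ) (integral_poisson_mul (f := fun z => z ^ (-k).toNat)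
      (Differentiable.diffContOnCl (by fun_prop)) hz)
    rw [← integral_conj] at this
    simpa using this

theorem continuous_toCircle_coe : Continuous fun t : UnitAddCircle => (AddCircle.toCircle t : ℂ) :=
  continuous_subtype_val.comp AddCircle.continuous_toCircle

theorem continuous_poisson {z : ℂ} (hz : ‖z‖ < 1) :
    Continuous fun t : UnitAddCircle => poisson z (AddCircle.toCircle t) := by
  unfold poisson
  have := continuous_toCircle_coe
  refine Continuous.div (by fun_prop) (by fun_prop) fun t => ?_
  have h1 : ‖(AddCircle.toCircle t : ℂ)‖ = 1 := Circle.norm_coe _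
  have h2 := norm_sub_norm_le (AddCircle.toCircle t : ℂ) z
  have : 0 < ‖(AddCircle.toCircle t : ℂ) - z‖ := by linarith
  positivity

theorem integral_prod_poisson_mul_mFourier {d : Type*} [Fintype d] (k : d → ℤ) {z : d → ℂ}
    (hz : ∀ i, ‖z i‖ < 1) :
    ∫ x : UnitAddTorus d, ((∏ i, poisson (z i) (AddCircle.toCircle (x i)) : ℝ) : ℂ) *
      UnitAddTorus.mFourier k x = ∏ i, harmonicPow (k i) (z i) := by
  simp_rw [UnitAddTorus.mFourier, ContinuousMap.coe_mk, Complex.ofReal_prod,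
    ← Finset.prod_mul_distrib]
  rw [integral_fintype_prod_volume_eq_prod
    (fun i t => (poisson (z i) (AddCircle.toCircle t) : ℂ) * fourier (k i) t)]
  exact Finset.prod_congr rfl fun i _ => integral_poisson_mul_fourier (k i) (hz i)

theorem integral_prod_poisson {d : Type*} [Fintype d] {z : d → ℂ} (hz : ∀ i, ‖z i‖ < 1) :
    ∫ x : UnitAddTorus d, ∏ i, poisson (z i) (AddCircle.toCircle (x i)) = 1 := by
  have := integral_prod_poisson_mul_mFourier (0 : d → ℤ) hz
  rw [UnitAddTorus.mFourier_zero] at this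
  simp only [ContinuousMap.one_apply, mul_one, Pi.zero_apply] at this
  rw [integral_complex_ofReal] at this
  simpa [harmonicPow] using this

instance : IsProbabilityMeasure (volume : Measure UnitAddCircle) := ⟨UnitAddCircle.measure_univ⟩

theorem integrable_of_continuous_torus {d : Type*} [Fintype d] {E : Type*} [NormedAddCommGroup E]
    {f : UnitAddTorus d → E} (hf : Continuous f) : Integrable f := by
  exact hf.integrable_of_hasCompactSupport (HasCompactSupport.of_compactSpace f)

theorem continuous_prod_poisson {d : Type*} [Fintype d] {z : d → ℂ} (hz : ∀ i, ‖z i‖ < 1) :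
    Continuous fun x : UnitAddTorus d => ∏ i, poisson (z i) (AddCircle.toCircle (x i)) :=
  continuous_finsetProd _ fun i _ => (continuous_poisson (hz i)).comp (continuous_apply i)

theorem integrable_prod_poisson_mul {d : Type*} [Fintype d] {z : d → ℂ} (hz : ∀ i, ‖z i‖ < 1)
    (g : C(UnitAddTorus d, ℂ)) :
    Integrable fun x : UnitAddTorus d =>
      ((∏ i, poisson (z i) (AddCircle.toCircle (x i)) : ℝ) : ℂ) * g x :=
  integrable_of_continuous_torus
    ((Complex.continuous_ofReal.comp (continuous_prod_poisson hz)).mul g.continuous)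

theorem norm_integral_prod_poisson_mul_le {d : Type*} [Fintype d] {z : d → ℂ} (hz : ∀ i, ‖z i‖ < 1)
    (g : C(UnitAddTorus d, ℂ)) :
    ‖∫ x : UnitAddTorus d, ((∏ i, poisson (z i) (AddCircle.toCircle (x i)) : ℝ) : ℂ) * g x‖ ≤
      ‖g‖ := by
  calc _ ≤ ∫ x : UnitAddTorus d, (∏ i, poisson (z i) (AddCircle.toCircle (x i))) * ‖g‖ := by
        refine norm_integral_le_of_norm_le
          (integrable_of_continuous_torus ((continuous_prod_poisson hz).mul_const _))
          (Eventually.of_forall fun x => ?_)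
        have h0 : 0 ≤ ∏ i, poisson (z i) (AddCircle.toCircle (x i)) :=
          Finset.prod_nonneg fun i _ => poisson_nonneg (hz i).le _
        rw [norm_mul, Complex.norm_real, Real.norm_of_nonneg h0]
        exact mul_le_mul_of_nonneg_left (g.norm_coe_le_norm x) h0
    _ = ‖g‖ := by rw [integral_mul_const, integral_prod_poisson hz, one_mul]

theorem tendsto_integral_prod_poisson_mul {d : Type*} [Fintype d] {z : ℕ → d → ℂ}
    (hz : ∀ m i, ‖z m i‖ < 1) {y : UnitAddTorus d}
    (hzy : ∀ i, Tendsto (fun m => z m i) atTop (nhds (AddCircle.toCircle (y i) : ℂ)))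
    (g : C(UnitAddTorus d, ℂ)) :
    Tendsto (fun m => ∫ x : UnitAddTorus d,
      ((∏ i, poisson (z m i) (AddCircle.toCircle (x i)) : ℝ) : ℂ) * g x) atTop (nhds (g y)) := by
  have hspan : ∀ g ∈ Submodule.span ℂ (range (UnitAddTorus.mFourier (d := d))),
      Tendsto (fun m => ∫ x : UnitAddTorus d,
        ((∏ i, poisson (z m i) (AddCircle.toCircle (x i)) : ℝ) : ℂ) * g x) atTop (nhds (g y)) := by
    intro g hg
    induction hg using Submodule.span_induction with
    | mem g hg =>
      obtain ⟨k, rfl⟩ := hg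
      simp_rw [fun m => integral_prod_poisson_mul_mFourier k (hz m)]
      have e : UnitAddTorus.mFourier k y = ∏ i, harmonicPow (k i) (AddCircle.toCircle (y i)) := by
        simp [UnitAddTorus.mFourier, harmonicPow_toCircle]
      rw [e]
      exact tendsto_finsetProd _ fun i _ => ((continuous_harmonicPow (k i)).tendsto _).comp (hzy i)
    | zero => simp
    | add g₁ g₂ _ _ h₁ h₂ =>
      refine (h₁.add h₂).congr fun m => ?_
      rw [← integral_add (integrable_prod_poisson_mul (hz m) g₁)
        (integrable_prod_poisson_mul (hz m) g₂)]
      simp [mul_add]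
    | smul c g _ h =>
      refine (h.const_mul c).congr fun m => ?_
      rw [← integral_const_mul]
      congr 1 with x
      simp only [ContinuousMap.smul_apply, smul_eq_mul]
      ring
  have hg : g ∈ (Submodule.span ℂ (range (UnitAddTorus.mFourier (d := d)))).topologicalClosure := by
    rw [UnitAddTorus.span_mFourier_closure_eq_top]
    trivial
  rw [Metric.tendsto_nhds]
  intro ε hε
  obtain ⟨g', hg', hd⟩ := Metric.mem_closure_iff.1 hg (ε / 3) (by positivity)
  filter_upwards [Metric.tendsto_nhds.1 (hspan g' hg') (ε / 3) (by positivity)] with m hm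
  have h1 : dist (g' y) (g y) ≤ dist g g' := by
    rw [dist_comm]
    exact ContinuousMap.dist_apply_le_dist y
  have h2 := norm_integral_prod_poisson_mul_le (hz m) (g - g')
  simp only [ContinuousMap.sub_apply, mul_sub] at h2
  rw [integral_sub (integrable_prod_poisson_mul (hz m) g) (integrable_prod_poisson_mul (hz m) g'),
    ← dist_eq_norm, ← dist_eq_norm] at h2
  calc _ ≤ _ := dist_triangle4 _ _ _ _
    _ < ε / 3 + ε / 3 + ε / 3 := by
      gcongr
      · exact h2.trans_lt hd
      · exact h1.trans_lt hd
    _ = ε := by ring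

@[simp]
theorem norm_toCircle (t : UnitAddCircle) : ‖(AddCircle.toCircle t : ℂ)‖ = 1 := Circle.norm_coe _

/-- The parametrization of the unit torus by `(ℝ/ℤ)^ι`. -/
def torusParam {ι : Type*} (x : UnitAddTorus ι) : EuclideanSpace ℂ ι :=
  WithLp.toLp 2 fun i => (AddCircle.toCircle (x i) : ℂ)

@[simp]
theorem torusParam_apply {ι : Type*} (x : UnitAddTorus ι) (i : ι) :
    torusParam x i = AddCircle.toCircle (x i) := rfl

theorem torusParam_mem {ι : Type*} (x : UnitAddTorus ι) : torusParam x ∈ torus ι :=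
  fun _ => Circle.norm_coe _

theorem continuous_torusParam {ι : Type*} [Fintype ι] :
    Continuous (torusParam : UnitAddTorus ι → EuclideanSpace ℂ ι) :=
  (PiLp.continuous_toLp 2 _).comp
    (continuous_pi fun i => continuous_toCircle_coe.comp (continuous_apply i))

theorem exists_toCircle_eq {z : ℂ} (hz : ‖z‖ = 1) :
    ∃ t : UnitAddCircle, (AddCircle.toCircle t : ℂ) = z := by
  refine ⟨((z.arg / (2 * Real.pi) : ℝ) : UnitAddCircle), ?_⟩
  rw [AddCircle.toCircle_apply_mk, div_one, mul_div_cancel₀ _ (by positivity), Circle.coe_exp]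
  simpa [hz] using Complex.norm_mul_exp_arg_mul_I z

theorem exists_torusParam_eq {ι : Type*} {ζ : EuclideanSpace ℂ ι} (hζ : ζ ∈ torus ι) :
    ∃ x, torusParam x = ζ := by
  choose x hx using fun i => exists_toCircle_eq (hζ i)
  exact ⟨x, by ext i; exact hx i⟩

theorem poisson_smul_comm (R : ℝ) (x y : UnitAddCircle) :
    poisson (R * AddCircle.toCircle x) (AddCircle.toCircle y) =
      poisson (R * AddCircle.toCircle y) (AddCircle.toCircle x) := by
  have h : ∀ x y : UnitAddCircle, ‖(AddCircle.toCircle y : ℂ) - R * AddCircle.toCircle x‖ =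
      ‖1 - R * ((AddCircle.toCircle x : ℂ) * (starRingEnd ℂ) (AddCircle.toCircle y : ℂ))‖ := by
    intro x y
    have e : (AddCircle.toCircle y : ℂ) * (starRingEnd ℂ) (AddCircle.toCircle y : ℂ) = 1 := by
      rw [Complex.mul_conj, Circle.normSq_coe, Complex.ofReal_one]
    calc _ = ‖((AddCircle.toCircle y : ℂ) - R * AddCircle.toCircle x) *
          (starRingEnd ℂ) (AddCircle.toCircle y : ℂ)‖ := by simp
      _ = _ := by rw [sub_mul, e, mul_assoc]
  have h2 : ‖(AddCircle.toCircle y : ℂ) - R * AddCircle.toCircle x‖ =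
      ‖(AddCircle.toCircle x : ℂ) - R * AddCircle.toCircle y‖ := by
    rw [h x y, h y x, ← Complex.norm_conj]
    simp [mul_comm]
  simp [poisson, h2]

theorem norm_ofReal_mul_toCircle {R : ℝ} (hR : 0 ≤ R) (t : UnitAddCircle) :
    ‖(R : ℂ) * AddCircle.toCircle t‖ = R := by
  simp [abs_of_nonneg hR]

theorem smul_torusParam_mem_polydisc {n : ℕ} {R : ℝ} (hR : 0 ≤ R) (hR1 : R < 1)
    (x : UnitAddTorus (Fin n)) : (R : ℂ) • torusParam x ∈ polydisc n := fun i => by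
  rw [PiLp.smul_apply, smul_eq_mul, torusParam_apply, norm_ofReal_mul_toCircle hR]
  exact hR1

theorem IsClarkMeasure.integral_prod_poisson {n : ℕ} {φ : EuclideanSpace ℂ (Fin n) → ℂ} {α : ℂ}
    {μ : Measure (EuclideanSpace ℂ (Fin n))} (hμ : IsClarkMeasure n φ α μ)
    (hφ : ∀ z ∈ polydisc n, ‖φ z‖ < 1) {z : EuclideanSpace ℂ (Fin n)} (hz : z ∈ polydisc n) :
    ∫ ζ, ∏ j, poisson (z j) (ζ j) ∂μ = (1 - ‖φ z‖ ^ 2) / ‖α - φ z‖ ^ 2 := by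
  have h1 := hφ z hz
  have h2 : 0 ≤ 1 - ‖φ z‖ ^ 2 := by nlinarith [norm_nonneg (φ z)]
  rw [integral_eq_lintegral_of_nonneg_ae
    (Eventually.of_forall fun ζ => Finset.prod_nonneg fun i _ => poisson_nonneg (hz i).le _)
    (measurable_prod_poisson z).aestronglyMeasurable, hμ.lintegral_prod_poisson hz,
    ENNReal.toReal_ofReal (by positivity)]

/-- A continuous function on the torus which is orthogonal to all dilates of the Poisson integral
of a Clark measure has integral zero. -/
theorem IsClarkMeasure.integral_eq_zero {n : ℕ} {φ : EuclideanSpace ℂ (Fin n) → ℂ} {α : ℂ}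
    {μ : Measure (EuclideanSpace ℂ (Fin n))} (hμ : IsClarkMeasure n φ α μ)
    (hφ : ∀ z ∈ polydisc n, ‖φ z‖ < 1)
    {G : EuclideanSpace ℂ (Fin n) → ℂ} (hG : Continuous fun x => G (torusParam x))
    (h : ∀ R : ℝ, 0 < R → R < 1 → ∫ x : UnitAddTorus (Fin n),
      (((1 - ‖φ ((R : ℂ) • torusParam x)‖ ^ 2) / ‖α - φ ((R : ℂ) • torusParam x)‖ ^ 2 : ℝ) : ℂ) *
        G (torusParam x) = 0) :
    ∫ ζ, G ζ ∂μ = 0 := by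
  have := hμ.1
  let g : C(UnitAddTorus (Fin n), ℂ) := ⟨fun x => G (torusParam x), hG⟩
  let R : ℕ → ℝ := fun m => 1 - 1 / (m + 2)
  have hR0 : ∀ m, 0 < R m := fun m => by
    have : (0 : ℝ) ≤ m := m.cast_nonneg
    simp only [R, sub_pos]
    rw [div_lt_one (by linarith)]
    linarith
  have hR1 : ∀ m, R m < 1 := fun m => by
    have : (0 : ℝ) < 1 / (m + 2) := by positivity
    simp only [R]
    linarith
  have hRlim : Tendsto R atTop (nhds 1) := by
    have : Tendsto (fun m : ℕ => 1 / ((m : ℝ) + 2)) atTop (nhds 0) :=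
      tendsto_const_nhds.div_atTop (tendsto_atTop_add_const_right _ _ tendsto_natCast_atTop_atTop)
    simpa [R] using this.const_sub 1
  let k : ℕ → EuclideanSpace ℂ (Fin n) → UnitAddTorus (Fin n) → ℂ := fun m ζ x =>
    ((∏ i, poisson ((R m : ℂ) * AddCircle.toCircle (x i)) (ζ i) : ℝ) : ℂ) * g x
  have hkz : ∀ m (x : UnitAddTorus (Fin n)) i, ‖(R m : ℂ) * AddCircle.toCircle (x i)‖ < 1 :=
    fun m x i => by
      rw [norm_ofReal_mul_toCircle (hR0 m).le]
      exact hR1 m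
  have hswap : ∀ m (x y : UnitAddTorus (Fin n)), k m (torusParam y) x =
      ((∏ i, poisson ((R m : ℂ) * AddCircle.toCircle (y i)) (AddCircle.toCircle (x i)) : ℝ) : ℂ) *
        g x := fun m x y => by
    simp only [k, torusParam_apply]
    simp_rw [fun i => poisson_smul_comm (R m) (x i) (y i)]
  have hmeas : ∀ m, Measurable fun p : EuclideanSpace ℂ (Fin n) × UnitAddTorus (Fin n) =>
      k m p.1 p.2 := by
    intro m
    refine Measurable.mul (Complex.measurable_ofReal.comp (Finset.measurable_prod _ fun i _ => ?_))
      (g.continuous.measurable.comp measurable_snd)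
    have hc : Continuous fun p : EuclideanSpace ℂ (Fin n) × UnitAddTorus (Fin n) =>
        (AddCircle.toCircle (p.2 i) : ℂ) :=
      continuous_toCircle_coe.comp ((continuous_apply i).comp continuous_snd)
    exact Measurable.div (Continuous.measurable (by fun_prop)) (Continuous.measurable (by fun_prop))
  have hinteg : ∀ m, Integrable (fun p : EuclideanSpace ℂ (Fin n) × UnitAddTorus (Fin n) =>
      k m p.1 p.2) (μ.prod volume) := by
    intro m
    refine Integrable.of_bound (hmeas m).aestronglyMeasurable
      ((2 / (1 - R m)) ^ n * ‖g‖) ?_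
    have hae : ∀ᵐ p ∂(μ.prod (volume : Measure (UnitAddTorus (Fin n)))), p.1 ∈ torus (Fin n) :=
      Measure.quasiMeasurePreserving_fst.ae hμ.ae_mem_torus
    filter_upwards [hae] with p hp
    rw [norm_mul, Complex.norm_real]
    have h0 : ∀ i ∈ Finset.univ, 0 ≤ poisson ((R m : ℂ) * AddCircle.toCircle (p.2 i)) (p.1 i) :=
      fun i _ => poisson_nonneg (hkz m p.2 i).le _
    rw [Real.norm_of_nonneg (Finset.prod_nonneg h0)]
    have h1 : ∏ i, poisson ((R m : ℂ) * AddCircle.toCircle (p.2 i)) (p.1 i) ≤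
        (2 / (1 - R m)) ^ n := by
      calc _ ≤ ∏ _i : Fin n, 2 / (1 - R m) := by
            refine Finset.prod_le_prod h0 fun i _ => ?_
            have := poisson_le (hkz m p.2 i) (hp i)
            rwa [norm_ofReal_mul_toCircle (hR0 m).le] at this
        _ = _ := by simp [div_pow]
    exact mul_le_mul h1 (g.norm_coe_le_norm _) (norm_nonneg _)
      (by have := hR1 m; have : 0 < 1 - R m := by linarith
          positivity)
  have hzero : ∀ m, ∫ ζ, (∫ x, k m ζ x) ∂μ = 0 := by
    intro m
    rw [integral_integral_swap (hinteg m), ← h (R m) (hR0 m) (hR1 m)]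
    congr 1 with x
    have e := hμ.integral_prod_poisson hφ (smul_torusParam_mem_polydisc (hR0 m).le (hR1 m) x)
    simp only [PiLp.smul_apply, torusParam_apply, smul_eq_mul] at e
    simp only [k]
    rw [integral_mul_const, integral_complex_ofReal, e]
    simp only [g, ContinuousMap.coe_mk]
  have hlim : Tendsto (fun m => ∫ ζ, (∫ x, k m ζ x) ∂μ) atTop (nhds (∫ ζ, G ζ ∂μ)) := by
    refine tendsto_integral_of_dominated_convergence (fun _ => ‖g‖)
      (fun m => (hinteg m).integral_prod_left.aestronglyMeasurable) (integrable_const _)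
      (fun m => ?_) ?_
    · filter_upwards [hμ.ae_mem_torus] with ζ hζ
      obtain ⟨y, rfl⟩ := exists_torusParam_eq hζ
      simp_rw [hswap]
      exact norm_integral_prod_poisson_mul_le (hkz m y) g
    · filter_upwards [hμ.ae_mem_torus] with ζ hζ
      obtain ⟨y, rfl⟩ := exists_torusParam_eq hζ
      simp_rw [hswap]
      refine tendsto_integral_prod_poisson_mul (fun m => hkz m y) (fun i => ?_) g
      have := ((Complex.continuous_ofReal.tendsto _).comp hRlim).mul_const
        (AddCircle.toCircle (y i) : ℂ)
      simpa using this
  simp_rw [hzero] at hlim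
  exact tendsto_nhds_unique hlim tendsto_const_nhds

/-- Multiplication of the coordinates in `J` by `c`. -/
def rotate {ι : Type*} (J : Set ι) [DecidablePred (· ∈ J)] (c : ℂ) (z : EuclideanSpace ℂ ι) :
    EuclideanSpace ℂ ι :=
  WithLp.toLp 2 fun i => if i ∈ J then c * z i else z i

theorem rotate_apply {ι : Type*} (J : Set ι) [DecidablePred (· ∈ J)] (c : ℂ)
    (z : EuclideanSpace ℂ ι) (i : ι) : rotate J c z i = if i ∈ J then c * z i else z i := rfl

theorem torusParam_add_indicator {ι : Type*} (J : Set ι) [DecidablePred (· ∈ J)]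
    (x : UnitAddTorus ι) (t : UnitAddCircle) :
    torusParam (x + J.indicator fun _ => t) = rotate J (AddCircle.toCircle t) (torusParam x) := by
  ext i
  rw [rotate_apply, torusParam_apply, torusParam_apply, Pi.add_apply, Set.indicator_apply]
  split_ifs
  · rw [AddCircle.toCircle_add, Circle.coe_mul, mul_comm]
  · rw [add_zero]

theorem integral_eq_zero_of_rotation {ι : Type*} [Fintype ι] (J : Set ι) [DecidablePred (· ∈ J)]
    {h : UnitAddTorus ι → ℂ} (hc : Continuous h)
    (h0 : ∀ x, ∫ t : UnitAddCircle, h (x + J.indicator fun _ => t) = 0) : ∫ x, h x = 0 := by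
  have hcont : Continuous fun p : UnitAddCircle × UnitAddTorus ι =>
      h (p.2 + J.indicator fun _ => p.1) := by
    refine hc.comp (continuous_snd.add (continuous_pi fun i => ?_))
    by_cases hi : i ∈ J
    · simpa [hi] using continuous_fst
    · simpa [hi] using continuous_const
  calc ∫ x, h x = ∫ _t : UnitAddCircle, ∫ x, h x := by simp
    _ = ∫ t : UnitAddCircle, ∫ x, h (x + J.indicator fun _ => t) := by
        congr 1 with t
        exact (integral_add_right_eq_self h _).symm
    _ = ∫ x, ∫ t : UnitAddCircle, h (x + J.indicator fun _ => t) := by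
        exact integral_integral_swap
          (hcont.integrable_of_hasCompactSupport (HasCompactSupport.of_compactSpace _))
    _ = 0 := by simp [h0]

theorem integral_torusParam_eq_zero {ι : Type*} [Fintype ι] (J : Set ι) [DecidablePred (· ∈ J)]
    {P : EuclideanSpace ℂ ι → ℂ} (hc : Continuous fun x => P (torusParam x))
    (h : ∀ ζ ∈ torus ι, ∃ f : ℂ → ℂ, DiffContOnCl ℂ f (Metric.ball 0 1) ∧ f 0 = 0 ∧
      ∀ c, ‖c‖ = 1 → P (rotate J c ζ) = f c) :
    ∫ x : UnitAddTorus ι, P (torusParam x) = 0 := by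
  refine integral_eq_zero_of_rotation J hc fun x => ?_
  obtain ⟨f, hf, hf0, hPf⟩ := h _ (torusParam_mem x)
  simp_rw [torusParam_add_indicator, fun t => hPf _ (norm_toCircle t)]
  rw [integral_comp_toCircle_of_diffContOnCl hf, hf0]

theorem prod_rotate_pow {ι : Type*} [Fintype ι] (J : Set ι) [DecidablePred (· ∈ J)] (c : ℂ)
    (z : EuclideanSpace ℂ ι) (k : ι → ℕ) :
    ∏ i, rotate J c z i ^ k i = c ^ (∑ i, if i ∈ J then k i else 0) * ∏ i, z i ^ k i := by
  rw [← Finset.prod_pow_eq_pow_sum, ← Finset.prod_mul_distrib]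
  refine Finset.prod_congr rfl fun i _ => ?_
  rw [rotate_apply]
  split_ifs
  · rw [mul_pow]
  · simp

theorem smul_rotate_mem_polydisc {n : ℕ} (J : Set (Fin n)) [DecidablePred (· ∈ J)] {R : ℝ}
    (hR : 0 < R) (hR1 : R < 1) {ζ : EuclideanSpace ℂ (Fin n)} (hζ : ζ ∈ torus (Fin n)) {c : ℂ}
    (hc : ‖c‖ < 1 / R) : (R : ℂ) • rotate J c ζ ∈ polydisc n := fun i => by
  rw [PiLp.smul_apply, smul_eq_mul, rotate_apply, norm_mul, Complex.norm_real,
    Real.norm_of_nonneg hR.le]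
  split_ifs
  · rw [norm_mul, hζ i, mul_one]
    rwa [lt_div_iff₀' hR] at hc
  · rwa [hζ i, mul_one]

theorem diffContOnCl_comp_rotate {n : ℕ} (J : Set (Fin n)) [DecidablePred (· ∈ J)] {R : ℝ}
    (hR : 0 < R) (hR1 : R < 1) {ζ : EuclideanSpace ℂ (Fin n)} (hζ : ζ ∈ torus (Fin n))
    {H : EuclideanSpace ℂ (Fin n) → ℂ} (hH : DifferentiableOn ℂ H (polydisc n)) :
    DiffContOnCl ℂ (fun c => H ((R : ℂ) • rotate J c ζ)) (Metric.ball 0 1) := by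
  have hd : Differentiable ℂ fun c => (R : ℂ) • rotate J c ζ := by
    rw [differentiable_euclidean]
    intro i
    simp only [PiLp.smul_apply, rotate_apply]
    split_ifs <;> fun_prop
  refine DifferentiableOn.diffContOnCl_ball (U := Metric.ball 0 (1 / R))
    (hH.comp hd.differentiableOn fun c hc => ?_) (Metric.closedBall_subset_ball ?_)
  · exact smul_rotate_mem_polydisc J hR hR1 hζ (by simpa using hc)
  · rwa [lt_div_iff₀ hR, one_mul]

theorem herglotz_re {α w : ℂ} (hα : ‖α‖ = 1) :
    (((1 - ‖w‖ ^ 2) / ‖α - w‖ ^ 2 : ℝ) : ℂ) =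
      ((α + w) / (α - w) + (starRingEnd ℂ) ((α + w) / (α - w))) / 2 := by
  rw [← Complex.re_eq_add_conj, Complex.div_re, ← add_div, ← Complex.normSq_eq_norm_sq (α - w)]
  congr 2
  have h1 : α.re * α.re + α.im * α.im = 1 := by
    rw [← Complex.normSq_apply, Complex.normSq_eq_norm_sq, hα, one_pow]
  rw [← Complex.normSq_eq_norm_sq, Complex.normSq_apply]
  simp only [Complex.add_re, Complex.sub_re, Complex.add_im, Complex.sub_im]
  linarith

/-- Orthogonality of a monomial divisible by `ζ_j` to a function of the remaining variables
vanishing at the origin to an order exceeding the degree of the monomial. -/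
theorem IsClarkMeasure.integral_monomial_mul_conj_eq_zero {n : ℕ} {p q : MvPolynomial (Fin n) ℂ}
    {φ : EuclideanSpace ℂ (Fin n) → ℂ} (h : IsRationalInner n p q φ) {α : ℂ} (hα : ‖α‖ = 1)
    {μ : Measure (EuclideanSpace ℂ (Fin n))} (hμ : IsClarkMeasure n φ α μ) (j : Fin n)
    {F : EuclideanSpace ℂ {i : Fin n // i ≠ j} → ℂ} (hFc : Continuous fun x => F (torusParam x))
    {N : ℕ} (hF : ∀ w ∈ torus {i : Fin n // i ≠ j}, ∃ D : ℂ → ℂ,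
      DiffContOnCl ℂ D (Metric.ball 0 1) ∧ ∀ c : ℂ, ‖c‖ = 1 → F (c • w) = c ^ N * D c)
    {k : Fin n → ℕ} (hk : k j ≠ 0) (hkN : ∑ i, (if i ∈ ({j}ᶜ : Set (Fin n)) then k i else 0) < N) :
    ∫ ζ, (∏ i, ζ i ^ k i) * (starRingEnd ℂ) (F (deleteCoord j ζ)) ∂μ = 0 := by
  set H : EuclideanSpace ℂ (Fin n) → ℂ := fun z => (α + φ z) / (α - φ z) with hH
  have hHd : DifferentiableOn ℂ H (polydisc n) := by
    have hφ := h.differentiableOn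
    simp only [hH, div_eq_mul_inv]
    refine (hφ.const_add α).fun_mul ((hφ.const_sub α).fun_inv fun z hz h0 => ?_)
    have := h.abs_lt_one z hz
    rw [← sub_eq_zero.1 h0, hα] at this
    exact lt_irrefl _ this
  have hFc' : Continuous fun x : UnitAddTorus (Fin n) => F (deleteCoord j (torusParam x)) :=
    hFc.comp (continuous_pi fun i => continuous_apply i.1)
  have hPc : Continuous fun x : UnitAddTorus (Fin n) => ∏ i, torusParam x i ^ k i :=
    continuous_finsetProd _ fun i _ =>
      (continuous_toCircle_coe.comp (continuous_apply i)).pow _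
  refine hμ.integral_eq_zero h.abs_lt_one
    (hPc.mul (Complex.continuous_conj.comp hFc')) fun R hR hR1 => ?_
  have hHc : Continuous fun x : UnitAddTorus (Fin n) => H ((R : ℂ) • torusParam x) :=
    hHd.continuousOn.comp_continuous ((continuous_const_smul (R : ℂ)).comp continuous_torusParam)
      fun x => smul_torusParam_mem_polydisc hR.le hR1 x
  set P₁ : EuclideanSpace ℂ (Fin n) → ℂ := fun ζ =>
    H ((R : ℂ) • ζ) * ((∏ i, ζ i ^ k i) * (starRingEnd ℂ) (F (deleteCoord j ζ))) with hP₁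
  set P₂ : EuclideanSpace ℂ (Fin n) → ℂ := fun ζ =>
    H ((R : ℂ) • ζ) * ((starRingEnd ℂ) (∏ i, ζ i ^ k i) * F (deleteCoord j ζ)) with hP₂
  have hc₁ : Continuous fun x => P₁ (torusParam x) :=
    hHc.mul (hPc.mul (Complex.continuous_conj.comp hFc'))
  have hc₂ : Continuous fun x => P₂ (torusParam x) :=
    hHc.mul ((Complex.continuous_conj.comp hPc).mul hFc')
  have h₁ : ∫ x, P₁ (torusParam x) = 0 := by
    classical
    refine integral_torusParam_eq_zero {j} hc₁ fun ζ hζ => ?_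
    refine ⟨fun c => c ^ k j * (H ((R : ℂ) • rotate {j} c ζ) * ((∏ i, ζ i ^ k i) *
      (starRingEnd ℂ) (F (deleteCoord j ζ)))), ?_, by simp [hk], fun c _ => ?_⟩
    · exact ((differentiable_id (𝕜 := ℂ) (E := ℂ)).pow _).diffContOnCl.smul
        ((diffContOnCl_comp_rotate {j} hR hR1 hζ hHd).smul (diffContOnCl_const (F := ℂ)))
    · have e : deleteCoord j (rotate {j} c ζ) = deleteCoord j ζ := by
        ext i
        simp [rotate_apply, i.2]
      simp only [hP₁, e, prod_rotate_pow, Set.mem_singleton_iff, Finset.sum_ite_eq',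
        Finset.mem_univ, if_true]
      ring
  have h₂ : ∫ x, P₂ (torusParam x) = 0 := by
    classical
    refine integral_torusParam_eq_zero {j}ᶜ hc₂ fun ζ hζ => ?_
    obtain ⟨D, hD, hFD⟩ := hF (deleteCoord j ζ) fun i => hζ i
    set K := ∑ i, (if i ∈ ({j}ᶜ : Set (Fin n)) then k i else 0) with hK
    refine ⟨fun c => c ^ (N - K) * (D c * (H ((R : ℂ) • rotate {j}ᶜ c ζ) *
      (starRingEnd ℂ) (∏ i, ζ i ^ k i))), ?_, ?_, fun c hc => ?_⟩
    · exact ((differentiable_id (𝕜 := ℂ) (E := ℂ)).pow _).diffContOnCl.smul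
        (hD.smul ((diffContOnCl_comp_rotate _ hR hR1 hζ hHd).smul (diffContOnCl_const (F := ℂ))))
    · simp [Nat.sub_ne_zero_of_lt hkN]
    · have e : deleteCoord j (rotate {j}ᶜ c ζ) = c • deleteCoord j ζ := by
        ext i
        simp [rotate_apply, i.2]
      have hcc : (starRingEnd ℂ) c ^ K * c ^ N = c ^ (N - K) := by
        conv_lhs => rw [← Nat.sub_add_cancel hkN.le, pow_add, mul_left_comm, ← mul_pow,
          Complex.conj_mul', hc]
        simp
      simp only [hP₂, e, prod_rotate_pow, hFD c hc, map_mul, map_pow, ← hcc]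
      rw [hK]
      ring
  have e : ∀ x : UnitAddTorus (Fin n),
      (((1 - ‖φ ((R : ℂ) • torusParam x)‖ ^ 2) / ‖α - φ ((R : ℂ) • torusParam x)‖ ^ 2 : ℝ) : ℂ) *
        ((∏ i, torusParam x i ^ k i) * (starRingEnd ℂ) (F (deleteCoord j (torusParam x)))) =
      (P₁ (torusParam x) + (starRingEnd ℂ) (P₂ (torusParam x))) / 2 := fun x => by
    rw [herglotz_re hα]
    simp only [hP₁, hP₂, hH, map_mul, Complex.conj_conj]
    ring
  simp_rw [e]
  have hc₂' : Continuous fun x => (starRingEnd ℂ) (P₂ (torusParam x)) :=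
    Complex.continuous_conj.comp hc₂
  rw [integral_div, integral_add (integrable_of_continuous_torus hc₁)
    (integrable_of_continuous_torus hc₂'), integral_conj, h₁, h₂]
  simp

/-- The automorphism of the disc sending `c` to `0` and fixing `1`. -/
def mobius (c u : ℂ) : ℂ :=
  (u - c) * (1 - (starRingEnd ℂ) c * u)⁻¹ * ((1 - (starRingEnd ℂ) c) * (1 - c)⁻¹)

theorem mobius_self (c : ℂ) : mobius c c = 0 := by simp [mobius]

theorem norm_mobius_le_one {c u : ℂ} (hc : ‖c‖ < 1) (hu : ‖u‖ ≤ 1) : ‖mobius c u‖ ≤ 1 := by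
  have h1 : 1 - c ≠ 0 := fun h => by
    rw [← sub_eq_zero.1 h, norm_one] at hc
    exact lt_irrefl _ hc
  have h2 := norm_pos_iff.2 (one_sub_conj_mul_ne_zero hc hu)
  have h3 : ‖1 - (starRingEnd ℂ) c‖ = ‖1 - c‖ := by rw [← Complex.norm_conj]; simp
  have h4 := norm_one_sub_conj_mul_sq_sub c u
  have h5 : ‖u - c‖ ≤ ‖1 - (starRingEnd ℂ) c * u‖ := by
    refine abs_le_of_sq_le_sq' ?_ h2.le |>.2
    have : 0 ≤ (1 - ‖c‖ ^ 2) * (1 - ‖u‖ ^ 2) :=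
      mul_nonneg (by nlinarith [norm_nonneg c]) (by nlinarith [norm_nonneg u])
    linarith
  rw [mobius, norm_mul, norm_mul, norm_mul, norm_inv, norm_inv, h3,
    mul_inv_cancel₀ (norm_ne_zero_iff.2 h1), mul_one, ← div_eq_mul_inv]
  exact (div_le_one h2).2 h5

theorem norm_one_sub_mobius_le {c u : ℂ} (hc : ‖c‖ < 1) (hu : ‖u‖ ≤ 1) :
    ‖1 - mobius c u‖ ≤ 1 / (1 - ‖c‖) ^ 2 * ‖1 - u‖ := by
  have h1 : 1 - c ≠ 0 := fun h => by
    rw [← sub_eq_zero.1 h, norm_one] at hc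
    exact lt_irrefl _ hc
  have h2 := one_sub_conj_mul_ne_zero hc hu
  have h3 := one_sub_norm_le_norm_one_sub_conj_mul (c := c) hu
  have h4 : 1 - ‖c‖ ≤ ‖1 - c‖ := by simpa using norm_sub_norm_le (1 : ℂ) c
  have h5 : 0 < 1 - ‖c‖ := by linarith
  have e : 1 - mobius c u =
      (1 - c * (starRingEnd ℂ) c) / ((1 - (starRingEnd ℂ) c * u) * (1 - c)) * (1 - u) := by
    rw [mobius]
    generalize (starRingEnd ℂ) c = d at *
    have h2' : 1 - u * d ≠ 0 := by rwa [mul_comm]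
    field_simp
    ring
  rw [e, norm_mul, norm_div, norm_mul, Complex.mul_conj]
  refine mul_le_mul_of_nonneg_right ?_ (norm_nonneg _)
  refine div_le_div₀ zero_le_one ?_ (by positivity) (by rw [sq]; gcongr)
  rw [← Complex.ofReal_one, ← Complex.ofReal_sub, Complex.norm_real, Complex.normSq_eq_norm_sq,
    Real.norm_of_nonneg] <;> nlinarith [norm_nonneg c]

theorem norm_one_sub_pow_le {z : ℂ} (hz : ‖z‖ ≤ 1) (N : ℕ) : ‖1 - z ^ N‖ ≤ N * ‖1 - z‖ := by
  induction N with
  | zero => simp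
  | succ N ih =>
    calc ‖1 - z ^ (N + 1)‖ = ‖(1 - z) + z * (1 - z ^ N)‖ := by ring_nf
      _ ≤ ‖1 - z‖ + 1 * (N * ‖1 - z‖) := by
        refine (norm_add_le _ _).trans (add_le_add_right ?_ _)
        rw [norm_mul]
        gcongr
      _ = _ := by push_cast; ring

theorem DifferentiableOn.comp_mobius {E : Type*} [NormedAddCommGroup E] [NormedSpace ℂ E]
    {s : Set E} {f : E → ℂ} (hf : DifferentiableOn ℂ f s) {c : ℂ} (hc : ‖c‖ < 1)
    (hs : ∀ z ∈ s, ‖f z‖ ≤ 1) : DifferentiableOn ℂ (fun z => mobius c (f z)) s := by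
  unfold mobius
  exact ((hf.sub_const c).fun_mul (((hf.const_mul _).const_sub 1).fun_inv fun z hz =>
    one_sub_conj_mul_ne_zero hc (hs z hz))).mul_const _

/-- Functions on `𝕋^{n-1}`, vanishing to high order at the origin, that approximate `1` on `K`. -/
theorem exists_approx_one {n : ℕ} {p q : MvPolynomial (Fin n) ℂ}
    {φ : EuclideanSpace ℂ (Fin n) → ℂ} (h : IsRationalInner n p q φ) {α : ℂ} (hα : ‖α‖ = 1)
    {j : Fin n} {a : ℂ} (ha : ‖a‖ < 1) {K : Set (EuclideanSpace ℂ {i : Fin n // i ≠ j})}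
    (hK : K ⊆ torus {i : Fin n // i ≠ j}) {C : ℝ} (hC : 0 < C)
    (hKC : ∀ v ∈ K, ∀ ρ : ℝ, 0 ≤ ρ → ρ < 1 →
        ‖α - φ (insertCoord j a ((ρ : ℂ) • v))‖ ≤ C * (1 - ρ)) :
    ∃ C' : ℝ, ∀ N : ℕ, ∃ F : EuclideanSpace ℂ {i : Fin n // i ≠ j} → ℂ,
      ContinuousOn F (torus {i : Fin n // i ≠ j}) ∧
      (∀ w ∈ torus {i : Fin n // i ≠ j}, ‖F w‖ ≤ 1) ∧
      (∀ w ∈ torus {i : Fin n // i ≠ j}, ∃ D : ℂ → ℂ, DiffContOnCl ℂ D (Metric.ball 0 1) ∧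
        ∀ c : ℂ, ‖c‖ = 1 → F (c • w) = c ^ N * D c) ∧
      ∀ v ∈ K, ‖1 - F v‖ ≤ C' / (N + 1) := by
  set g : EuclideanSpace ℂ (Fin n) → ℂ := fun z => (starRingEnd ℂ) α * φ z with hg
  have hgn : ∀ z ∈ polydisc n, ‖g z‖ < 1 := fun z hz => by
    rw [hg, norm_mul, Complex.norm_conj, hα, one_mul]
    exact h.abs_lt_one z hz
  have h0 : insertCoord j a 0 ∈ polydisc n :=
    (forall_insertCoord (P := fun z => ‖z‖ < 1)).2 ⟨ha, fun k => by simp⟩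
  set c := g (insertCoord j a 0) with hc
  have hc1 : ‖c‖ < 1 := hgn _ h0
  set G : EuclideanSpace ℂ (Fin n) → ℂ := fun z => mobius c (g z) with hG
  have hGd : DifferentiableOn ℂ G (polydisc n) := by
    have hφ := h.differentiableOn
    exact DifferentiableOn.comp_mobius (hφ.const_mul _) hc1 fun z hz => (hgn z hz).le
  have hGn : ∀ z ∈ polydisc n, ‖G z‖ ≤ 1 := fun z hz => norm_mobius_le_one hc1 (hgn z hz).le
  refine ⟨1 / (1 - ‖c‖) ^ 2 * C, fun N => ?_⟩
  have hN : (0 : ℝ) < 1 / (N + 2) ^ 2 := by positivity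
  set ρ : ℝ := 1 - 1 / (N + 2) ^ 2 with hρ
  have hρ0 : 0 < ρ := by
    rw [hρ, sub_pos, div_lt_one (by positivity)]
    nlinarith [(Nat.cast_nonneg N : (0 : ℝ) ≤ N)]
  have hρ1 : ρ < 1 := by linarith
  refine ⟨fun w => G (insertCoord j a ((ρ : ℂ) • w)) ^ N, ?_, fun w hw => ?_, fun w hw => ?_,
    fun v hv => ?_⟩
  · exact (hGd.continuousOn.comp ((continuous_insertCoord j a).comp
      (continuous_const_smul (ρ : ℂ))).continuousOn
        fun w hw => insertCoord_smul_mem_polydisc ha hw hρ0.le hρ1).pow N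
  · rw [norm_pow]
    exact pow_le_one₀ (norm_nonneg _) (hGn _ (insertCoord_smul_mem_polydisc ha hw hρ0.le hρ1))
  · set f : ℂ → ℂ := fun z => G (insertCoord j a ((ρ : ℂ) • z • w)) with hf
    have hfd : DifferentiableOn ℂ f (Metric.ball 0 (1 / ρ)) := by
      have hd : Differentiable ℂ fun z : ℂ => insertCoord j a ((ρ : ℂ) • z • w) := by
        rw [differentiable_euclidean]
        intro i
        simp only [insertCoord, PiLp.smul_apply]
        split_ifs <;> fun_prop
      refine hGd.comp hd.differentiableOn fun z hz =>
        (forall_insertCoord (P := fun z => ‖z‖ < 1)).2 ⟨ha, fun k => ?_⟩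
      have hz' : ‖z‖ < 1 / ρ := by simpa using hz
      rw [lt_div_iff₀' hρ0] at hz'
      simpa [hw k, abs_of_pos hρ0] using hz'
    have hf0 : f 0 = 0 := by simp [hf, hG, ← hc, mobius_self]
    have hfs : ∀ z, f z = z * dslope f 0 z := fun z => by
      simpa [hf0] using (sub_smul_dslope f 0 z).symm
    have hρ1' : 1 < 1 / ρ := by rwa [lt_div_iff₀ hρ0, one_mul]
    refine ⟨fun z => dslope f 0 z ^ N, ?_, fun z _ => ?_⟩
    · refine DifferentiableOn.diffContOnCl_ball (U := Metric.ball 0 (1 / ρ)) ?_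
        (Metric.closedBall_subset_ball hρ1')
      exact ((Complex.differentiableOn_dslope (Metric.ball_mem_nhds _ (by positivity))).2 hfd).pow N
    · rw [← mul_pow, ← hfs]
  · have hz := insertCoord_smul_mem_polydisc ha (hK hv) hρ0.le hρ1
    set z := insertCoord j a ((ρ : ℂ) • v) with hzd
    have h1 : ‖1 - g z‖ ≤ C * (1 - ρ) := by
      refine le_trans (le_of_eq ?_) (hKC v hv ρ hρ0.le hρ1)
      rw [show 1 - g z = (starRingEnd ℂ) α * (α - φ z) by
        rw [mul_sub, Complex.conj_mul', hα]; simp [hg], norm_mul, Complex.norm_conj, hα, one_mul]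
    have hB : 0 ≤ 1 / (1 - ‖c‖) ^ 2 := by positivity
    calc ‖1 - G z ^ N‖ ≤ N * ‖1 - G z‖ := norm_one_sub_pow_le (hGn z hz) N
      _ ≤ N * (1 / (1 - ‖c‖) ^ 2 * (C * (1 - ρ))) := by
        have := norm_one_sub_mobius_le hc1 (hgn z hz).le
        gcongr
        exact this.trans (by gcongr)
      _ = 1 / (1 - ‖c‖) ^ 2 * C * (N / (N + 2) ^ 2) := by rw [hρ]; ring
      _ ≤ 1 / (1 - ‖c‖) ^ 2 * C * (1 / (N + 1)) := by
        refine mul_le_mul_of_nonneg_left ?_ (by positivity)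
        rw [div_le_div_iff₀ (by positivity) (by positivity)]
        nlinarith [(Nat.cast_nonneg N : (0 : ℝ) ≤ N)]
      _ = _ := by ring

theorem IsClarkMeasure.integrable_of_continuousOn {n : ℕ} {φ : EuclideanSpace ℂ (Fin n) → ℂ} {α : ℂ}
    {μ : Measure (EuclideanSpace ℂ (Fin n))} (hμ : IsClarkMeasure n φ α μ)
    {f : EuclideanSpace ℂ (Fin n) → ℂ} (hf : ContinuousOn f (torus (Fin n))) : Integrable f μ := by
  have := hμ.1
  have := hf.integrableOn_compact (μ := μ) (isCompact_torus _)
  rwa [IntegrableOn, Measure.restrict_eq_self_of_ae_mem hμ.ae_mem_torus] at this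

theorem norm_integral_mul_le {X : Type*} [MeasurableSpace X] {μ : Measure X}
    [IsFiniteMeasure μ] (d : Lp ℂ 2 μ) {h : X → ℂ} (hh : ∀ᵐ x ∂μ, ‖h x‖ ≤ 1) :
    ‖∫ x, d x * h x ∂μ‖ ≤ ‖d‖ * (μ univ ^ (1 / 2 : ℝ)).toReal := by
  rw [Lp.norm_def, ← ENNReal.toReal_mul, ← toReal_enorm]
  refine ENNReal.toReal_mono (ENNReal.mul_ne_top (Lp.eLpNorm_ne_top d)
    (ENNReal.rpow_ne_top_of_nonneg (by norm_num) (measure_ne_top _ _))) ?_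
  calc ‖∫ x, d x * h x ∂μ‖ₑ ≤ ∫⁻ x, ‖d x * h x‖ₑ ∂μ := enorm_integral_le_lintegral_enorm _
    _ ≤ ∫⁻ x, ‖d x‖ₑ ∂μ := by
      refine lintegral_mono_ae ?_
      filter_upwards [hh] with x hx
      rw [enorm_le_iff_norm_le, norm_mul]
      exact mul_le_of_le_one_right (norm_nonneg _) hx
    _ = eLpNorm d 1 μ := eLpNorm_one_eq_lintegral_enorm.symm
    _ ≤ _ := by
      refine (eLpNorm_le_eLpNorm_mul_rpow_measure_univ (q := 2) (by norm_num)
        (Lp.aestronglyMeasurable d)).trans (le_of_eq ?_)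
      norm_num

theorem IsClarkMeasure.integral_pEval_mul_conj_eq_zero {n : ℕ} {p q : MvPolynomial (Fin n) ℂ}
    {φ : EuclideanSpace ℂ (Fin n) → ℂ} (h : IsRationalInner n p q φ) {α : ℂ} (hα : ‖α‖ = 1)
    {μ : Measure (EuclideanSpace ℂ (Fin n))} (hμ : IsClarkMeasure n φ α μ) (j : Fin n)
    {F : EuclideanSpace ℂ {i : Fin n // i ≠ j} → ℂ}
    (hFc : ContinuousOn F (torus {i : Fin n // i ≠ j}))
    {N : ℕ} (hF : ∀ w ∈ torus {i : Fin n // i ≠ j}, ∃ D : ℂ → ℂ,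
      DiffContOnCl ℂ D (Metric.ball 0 1) ∧ ∀ c : ℂ, ‖c‖ = 1 → F (c • w) = c ^ N * D c)
    {P : MvPolynomial (Fin n) ℂ} (hP : P.totalDegree < N) :
    ∫ ζ, pEval P ζ * (ζ j * (starRingEnd ℂ) (F (deleteCoord j ζ))) ∂μ = 0 := by
  have hFt : Continuous fun x => F (torusParam x) :=
    hFc.comp_continuous continuous_torusParam torusParam_mem
  have hFd : ContinuousOn (fun ζ => (starRingEnd ℂ) (F (deleteCoord j ζ))) (torus (Fin n)) :=
    Complex.continuous_conj.comp_continuousOn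
      (hFc.comp (continuous_deleteCoord j).continuousOn fun ζ hζ i => hζ i)
  have e : ∀ ζ : EuclideanSpace ℂ (Fin n),
      pEval P ζ * (ζ j * (starRingEnd ℂ) (F (deleteCoord j ζ))) =
      ∑ m ∈ P.support, P.coeff m *
        ((∏ i, ζ i ^ (m i + if i = j then 1 else 0)) * (starRingEnd ℂ) (F (deleteCoord j ζ))) := by
    intro ζ
    rw [pEval, MvPolynomial.eval_eq', Finset.sum_mul]
    refine Finset.sum_congr rfl fun m _ => ?_
    simp only [pow_add, Finset.prod_mul_distrib, pow_ite, pow_one, pow_zero, Finset.prod_ite_eq',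
      Finset.mem_univ, if_true]
    ring
  simp_rw [e]
  rw [integral_finsetSum]
  · refine Finset.sum_eq_zero fun m hm => ?_
    rw [integral_const_mul, IsClarkMeasure.integral_monomial_mul_conj_eq_zero h hα hμ j hFt hF
      (by simp), mul_zero]
    refine lt_of_le_of_lt ?_ hP
    refine le_trans ?_ (MvPolynomial.le_totalDegree hm)
    rw [Finsupp.sum_fintype _ _ fun _ => rfl]
    refine Finset.sum_le_sum fun i _ => ?_
    by_cases hi : i = j <;> simp [hi]
  · refine fun m _ => hμ.integrable_of_continuousOn ?_
    exact continuousOn_const.mul (ContinuousOn.mul (Continuous.continuousOn (by fun_prop)) hFd)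

theorem measure_cylinder_le {n : ℕ} {p q : MvPolynomial (Fin n) ℂ}
    {φ : EuclideanSpace ℂ (Fin n) → ℂ} (h : IsRationalInner n p q φ) {α : ℂ} (hα : ‖α‖ = 1)
    {μ : Measure (EuclideanSpace ℂ (Fin n))} [IsFiniteMeasure μ] (hμ : IsClarkMeasure n φ α μ)
    {j : Fin n} {a : ℂ} (ha : ‖a‖ < 1) {K : Set (EuclideanSpace ℂ {i : Fin n // i ≠ j})}
    (hKc : IsCompact K) (hK : K ⊆ torus {i : Fin n // i ≠ j}) {C : ℝ} (hC : 0 < C)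
    (hKC : ∀ v ∈ K, ∀ ρ : ℝ, 0 ≤ ρ → ρ < 1 →
        ‖α - φ (insertCoord j a ((ρ : ℂ) • v))‖ ≤ C * (1 - ρ))
    {f g : Lp ℂ 2 μ} (hf : f =ᵐ[μ] (deleteCoord j ⁻¹' K).indicator fun ζ => (starRingEnd ℂ) (ζ j))
    (hg : g ∈ polyLp n μ) :
    μ.real (deleteCoord j ⁻¹' K) ≤ ‖f - g‖ * (μ univ ^ (1 / 2 : ℝ)).toReal := by
  obtain ⟨P, hP⟩ := hg
  obtain ⟨C', hC'⟩ := exists_approx_one h hα ha hK hC hKC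
  set S := deleteCoord j ⁻¹' K with hS
  have hSm : MeasurableSet S := (hKc.isClosed.preimage (continuous_deleteCoord j)).measurableSet
  have hlim : Tendsto (fun N : ℕ => ‖f - g‖ * (μ univ ^ (1 / 2 : ℝ)).toReal +
      C' / (N + 1) * μ.real S) atTop
      (nhds (‖f - g‖ * (μ univ ^ (1 / 2 : ℝ)).toReal + 0 * μ.real S)) := by
    refine tendsto_const_nhds.add (Tendsto.mul_const _ ?_)
    simpa [div_eq_mul_inv] using
      (tendsto_one_div_add_atTop_nhds_zero_nat (𝕜 := ℝ)).const_mul C'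
  rw [zero_mul, add_zero] at hlim
  refine ge_of_tendsto hlim ?_
  filter_upwards [eventually_gt_atTop P.totalDegree] with N hN
  obtain ⟨F, hFc, hF1, hFD, hFK⟩ := hC' N
  have hFd : ContinuousOn (fun ζ => (starRingEnd ℂ) (F (deleteCoord j ζ))) (torus (Fin n)) :=
    Complex.continuous_conj.comp_continuousOn
      (hFc.comp (continuous_deleteCoord j).continuousOn fun ζ hζ i => hζ i)
  have h0 := IsClarkMeasure.integral_pEval_mul_conj_eq_zero h hα hμ j hFc hFD hN
  have hFi : Integrable (fun ζ => (starRingEnd ℂ) (F (deleteCoord j ζ))) μ :=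
    hμ.integrable_of_continuousOn hFd
  have hPi : Integrable (fun ζ => pEval P ζ * (ζ j * (starRingEnd ℂ) (F (deleteCoord j ζ)))) μ :=
    hμ.integrable_of_continuousOn ((continuous_pEval P).continuousOn.mul
      (ContinuousOn.mul (Continuous.continuousOn (by fun_prop)) hFd))
  have hdiff : ∫ ζ, (f - g : Lp ℂ 2 μ) ζ * (ζ j * (starRingEnd ℂ) (F (deleteCoord j ζ))) ∂μ =
      ∫ ζ in S, (starRingEnd ℂ) (F (deleteCoord j ζ)) ∂μ := by
    rw [← sub_zero (∫ ζ in S, (starRingEnd ℂ) (F (deleteCoord j ζ)) ∂μ), ← h0,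
      ← integral_indicator hSm, ← integral_sub (hFi.indicator hSm) hPi]
    refine integral_congr_ae ?_
    filter_upwards [Lp.coeFn_sub f g, hf, hP, hμ.ae_mem_torus] with ζ h1 h2 h3 h4
    rw [h1, Pi.sub_apply, h2, h3, sub_mul]
    congr 1
    by_cases hζ : ζ ∈ S
    · rw [indicator_of_mem hζ, indicator_of_mem hζ, ← mul_assoc, Complex.conj_mul', h4 j]
      simp
    · rw [indicator_of_notMem hζ, indicator_of_notMem hζ, zero_mul]
  have hle : ‖∫ ζ in S, (starRingEnd ℂ) (F (deleteCoord j ζ)) ∂μ‖ ≤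
      ‖f - g‖ * (μ univ ^ (1 / 2 : ℝ)).toReal := by
    rw [← hdiff]
    refine norm_integral_mul_le _ ?_
    filter_upwards [hμ.ae_mem_torus] with ζ hζ
    rw [norm_mul, hζ j, one_mul, Complex.norm_conj]
    exact hF1 _ fun i => hζ i
  have hclose : ‖∫ ζ in S, (1 - (starRingEnd ℂ) (F (deleteCoord j ζ))) ∂μ‖ ≤
      C' / (N + 1) * μ.real S := by
    refine norm_setIntegral_le_of_norm_le_const (measure_lt_top _ _) fun ζ hζ => ?_
    rw [← Complex.norm_conj]
    simpa using hFK _ hζ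
  rw [integral_sub (integrable_const _) hFi.integrableOn, setIntegral_const] at hclose
  have := norm_sub_norm_le (μ.real S • (1 : ℂ))
    (∫ ζ in S, (starRingEnd ℂ) (F (deleteCoord j ζ)) ∂μ)
  rw [norm_smul, norm_one, mul_one, Real.norm_of_nonneg measureReal_nonneg] at this
  linarith

theorem closure_polyLp_ne_univ {n : ℕ} (hn : 2 ≤ n) {p q : MvPolynomial (Fin n) ℂ}
    {φ : EuclideanSpace ℂ (Fin n) → ℂ} (h : IsRationalInner n p q φ) {α : ℂ} (hα : ‖α‖ = 1)
    {μ : Measure (EuclideanSpace ℂ (Fin n))} (hμ : IsClarkMeasure n φ α μ)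
    {j : Fin n} {V : Set (EuclideanSpace ℂ {i : Fin n // i ≠ j})} (hVc : IsClosed V)
    (hVt : V ⊆ torus {i : Fin n // i ≠ j}) (hV : 0 < μH[(n : ℝ) - 2] V)
    (hcl : {ζ | ζ ∈ torus (Fin n) ∧ deleteCoord j ζ ∈ V} ⊆ closure (radialFiber φ α)) :
    closure (polyLp n μ) ≠ univ := by
  intro huniv
  have := hμ.1
  obtain ⟨a, K, C, ha, hKc, hKt, hK, hC, hKC⟩ := exists_compact_radial hn h hα hVc hVt hV hcl
  set S := deleteCoord j ⁻¹' K with hS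
  have hSm : MeasurableSet S := (hKc.isClosed.preimage (continuous_deleteCoord j)).measurableSet
  have hpos : 0 < μ.real S := ENNReal.toReal_pos
    (cylinder_measure_pos hn h hα hμ ha hKc hKt hK hC hKC).ne' (measure_ne_top _ _)
  have hmem : MemLp (S.indicator fun ζ : EuclideanSpace ℂ (Fin n) => (starRingEnd ℂ) (ζ j)) 2
      μ := by
    refine MemLp.indicator hSm (MemLp.of_bound
      (Continuous.aestronglyMeasurable (by fun_prop)) 1 ?_)
    filter_upwards [hμ.ae_mem_torus] with ζ hζ
    rw [Complex.norm_conj, hζ j]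
  set M := (μ univ ^ (1 / 2 : ℝ)).toReal with hM
  have hM0 : 0 ≤ M := ENNReal.toReal_nonneg
  obtain ⟨g, hg, hfg⟩ := Metric.mem_closure_iff.1 (huniv ▸ mem_univ hmem.toLp)
    (μ.real S / (M + 1)) (by positivity)
  have hle := measure_cylinder_le h hα hμ ha hKc hKt hC hKC hmem.coeFn_toLp hg
  rw [dist_eq_norm, lt_div_iff₀ (by positivity)] at hfg
  nlinarith [norm_nonneg (hmem.toLp - g)]

/-- If the closure of `φ₁⁻¹(α)` contains a set of the form `pr_j⁻¹(V)` with `V ⊆ 𝕋^{n-1}`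
real algebraic of positive `ℋ^{n-2}`-measure, then `H²(μ_α) ≠ L²(μ_α)`. -/
theorem H2_ne_L2_of_cylinder {n : ℕ} (hn : 2 ≤ n)
    (φ : EuclideanSpace ℂ (Fin n) → ℂ)
    (hφ : ∃ p q : MvPolynomial (Fin n) ℂ, IsRationalInner n p q φ)
    (α : ℂ) (hα : ‖α‖ = 1)
    (μ : Measure (EuclideanSpace ℂ (Fin n))) (hμ : IsClarkMeasure n φ α μ)
    (hcyl : ∃ (j : Fin n) (s : Finset (MvPolynomial ({i : Fin n // i ≠ j} × Bool) ℝ)),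
        0 < μH[(n : ℝ) - 2] (torus {i : Fin n // i ≠ j} ∩ realZeroSet s) ∧
        {ζ | ζ ∈ torus (Fin n) ∧
            deleteCoord j ζ ∈ torus {i : Fin n // i ≠ j} ∩ realZeroSet s}
          ⊆ closure (radialFiber φ α)) :
    closure (polyLp n μ) ≠ Set.univ := by
  obtain ⟨p, q, h⟩ := hφ
  obtain ⟨j, s, hV, hcl⟩ := hcyl
  exact closure_polyLp_ne_univ hn h hα hμ
    ((isCompact_torus _).isClosed.inter (isClosed_realZeroSet s)) inter_subset_left hV hcl

end
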